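/- (Theorem 2.2, existence.) Let k ≥ 0 be an integer and λ, μ ∈ ℝ with λ, μ ∉ {0, 1/n, 2/n, 3/n, …}. Then there exists a nonzero bilinear differential operator B_{2k}, of the form B_{2k}(f,g)(x) = Σ_{α,γ} b_{αγ} (∂^α f)(x)·(∂^γ g)(x) (a finite sum over multi-indices α, γ with constant real coefficients b_{αγ}, |α| + |γ| ≤ 2k), which is o(p+1,q+1)-invariant from F_λ ⊗ F_μ to F_{λ+μ+2k/n}. -/

import Mathlib

noncomputable section

/-- `ε_i = 1` for `i < p`, `ε_i = -1` for `i ≥ p`: the entries of the flat metric of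
signature `(p,q)` on `ℝⁿ`. -/
def eps (p : ℕ) {n : ℕ} (i : Fin n) : ℝ := if (i : ℕ) < p then 1 else -1

/-- The partial derivative `∂_i f`. -/
def pd {n : ℕ} (i : Fin n) (f : (Fin n → ℝ) → ℝ) : (Fin n → ℝ) → ℝ :=
  fun x => fderiv ℝ f x (Pi.single i 1)

/-- The iterated partial derivative `∂^α f` for a multi-index `α`. -/
def pdIter {n : ℕ} (α : Fin n → ℕ) (f : (Fin n → ℝ) → ℝ) : (Fin n → ℝ) → ℝ :=
  (List.finRange n).foldr (fun i g => (pd i)^[α i] g) f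

/-- The flat Laplacian of signature `(p,q)`: `Δf = Σ_i ε_i ∂_i² f`. -/
def lap (p : ℕ) {n : ℕ} (f : (Fin n → ℝ) → ℝ) : (Fin n → ℝ) → ℝ :=
  fun x => ∑ i, eps p i * pd i (pd i f) x

/-- The Lie derivative of a `l`-density along the vector field `X = Σ_i X^i ∂_i`:
`L_X^l f = Σ_i X^i ∂_i f + l·(Σ_i ∂_i X^i)·f`. -/
def lieD {n : ℕ} (X : (Fin n → ℝ) → (Fin n → ℝ)) (l : ℝ)
    (f : (Fin n → ℝ) → ℝ) : (Fin n → ℝ) → ℝ :=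
  fun x => (∑ i, X x i * pd i f x) + l * (∑ i, pd i (fun y => X y i) x) * f x

/-- Translation generator `X_i = ∂_i`. -/
def Xtrans {n : ℕ} (i : Fin n) : (Fin n → ℝ) → (Fin n → ℝ) := fun _ => Pi.single i 1

/-- Rotation generator `X_{ij} = x_i ∂_j − x_j ∂_i` (with `x_i = ε_i x^i`). -/
def Xrot (p : ℕ) {n : ℕ} (i j : Fin n) : (Fin n → ℝ) → (Fin n → ℝ) :=
  fun x => (eps p i * x i) • (Pi.single j 1 : Fin n → ℝ) - (eps p j * x j) • (Pi.single i 1 : Fin n → ℝ)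

/-- The Euler vector field `X_0 = Σ_i x^i ∂_i`. -/
def Xeuler {n : ℕ} : (Fin n → ℝ) → (Fin n → ℝ) := fun x => x

/-- Inversion generator `X̄_i = (Σ_j ε_j (x^j)²) ∂_i − 2 x_i Σ_j x^j ∂_j`. -/
def Xinv (p : ℕ) {n : ℕ} (i : Fin n) : (Fin n → ℝ) → (Fin n → ℝ) :=
  fun x => (∑ j, eps p j * (x j) ^ 2) • (Pi.single i 1 : Fin n → ℝ) - (2 * (eps p i * x i)) • x

/-- The generators of the conformal Lie algebra `o(p+1,q+1)` acting on `ℝⁿ`. -/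
def confGens (p n : ℕ) : Set ((Fin n → ℝ) → (Fin n → ℝ)) :=
  Set.range (Xtrans (n := n)) ∪ {X | ∃ i j, X = Xrot p i j} ∪ {Xeuler} ∪ Set.range (Xinv p)

/-- A bilinear differential operator `B` is `o(p+1,q+1)`-invariant from `F_λ ⊗ F_μ` to
`F_ν` if `L_X^ν(B(f,g)) = B(L_X^λ f, g) + B(f, L_X^μ g)` for every conformal generator `X`
and all smooth `f, g`. -/
def BiConfInv (p n : ℕ) (l m nu : ℝ)
    (B : ((Fin n → ℝ) → ℝ) → ((Fin n → ℝ) → ℝ) → ((Fin n → ℝ) → ℝ)) : Prop :=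
  ∀ X ∈ confGens p n, ∀ f g : (Fin n → ℝ) → ℝ, ContDiff ℝ (⊤ : ℕ∞) f → ContDiff ℝ (⊤ : ℕ∞) g →
    lieD X nu (B f g) = fun x => B (lieD X l f) g x + B f (lieD X m g) x

/-- The bilinear differential operator with constant coefficients `b`:
`B(f,g) = Σ_{α,γ} b_{αγ} (∂^α f)(∂^γ g)` (a finite sum over multi-indices bounded by `N`). -/
def Bop (n N : ℕ) (b : (Fin n → ℕ) → (Fin n → ℕ) → ℝ)
    (f g : (Fin n → ℝ) → ℝ) : (Fin n → ℝ) → ℝ :=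
  fun x => ∑ α ∈ Finset.Iic (fun _ => N : Fin n → ℕ), ∑ γ ∈ Finset.Iic (fun _ => N : Fin n → ℕ),
    b α γ * pdIter α f x * pdIter γ g x


def SysE (k : ℕ) (N a b : ℝ) (c : ℕ → ℕ → ℝ) : Prop :=
  (∀ r t : ℕ, k < r + t → c r t = 0) ∧
  (∀ r t : ℕ, ((r:ℝ)+1) * (2*N-4-4*a-4*r) * c (r+1) t
    + ((k:ℝ)-r-t+1) * ((k:ℝ)-r-t) * (if t = 0 then 0 else c r (t-1))
    - ((k:ℝ)-r-t) * (4*t+2*((k:ℝ)-1-r-t)+2*b) * c r t = 0) ∧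
  (∀ r t : ℕ, ((t:ℝ)+1) * (2*N-4-4*b-4*t) * c r (t+1)
    + ((k:ℝ)-r-t+1) * ((k:ℝ)-r-t) * (if r = 0 then 0 else c (r-1) t)
    - ((k:ℝ)-r-t) * (4*r+2*((k:ℝ)-1-r-t)+2*a) * c r t = 0)

theorem gen_sol (k : ℕ) (N a b : ℝ) (hA : ∀ r : ℕ, 2*N-4-4*a-4*(r:ℝ) ≠ 0)
    (hB : ∀ r : ℕ, 2*N-4-4*b-4*(r:ℝ) ≠ 0) :
    ∃ c : ℕ → ℕ → ℝ, c 0 0 = 1 ∧ SysE k N a b c := by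
  obtain ⟨c0, h00, h0⟩ : ∃ c0 : ℕ → ℝ, c0 0 = 1 ∧ ∀ t, c0 (t+1) =
      (((k:ℝ)-t) * (2*((k:ℝ)-1-t)+2*a) * c0 t) / (((t:ℝ)+1) * (2*N-4-4*b-4*t)) :=
    ⟨fun t => Nat.rec 1 (fun t y => (((k:ℝ)-t) * (2*((k:ℝ)-1-t)+2*a) * y) /
      (((t:ℝ)+1) * (2*N-4-4*b-4*t))) t, rfl, fun t => rfl⟩
  obtain ⟨c, hc0, hc⟩ : ∃ c : ℕ → ℕ → ℝ, c 0 = c0 ∧ ∀ r, c (r+1) = fun t =>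
      (((k:ℝ)-r-t) * (4*t+2*((k:ℝ)-1-r-t)+2*b) * c r t -
       ((k:ℝ)-r-t+1) * ((k:ℝ)-r-t) * (if t = 0 then 0 else c r (t-1))) /
        (((r:ℝ)+1) * (2*N-4-4*a-4*r)) :=
    ⟨fun r => Nat.rec c0 (fun r y => fun t =>
      (((k:ℝ)-r-t) * (4*t+2*((k:ℝ)-1-r-t)+2*b) * y t -
       ((k:ℝ)-r-t+1) * ((k:ℝ)-r-t) * (if t = 0 then 0 else y (t-1))) /
        (((r:ℝ)+1) * (2*N-4-4*a-4*r))) r, rfl, fun r => rfl⟩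
  have pA : ∀ r : ℕ, ((r:ℝ)+1) * (2*N-4-4*a-4*r) ≠ 0 := fun r =>
    mul_ne_zero (by positivity) (hA r)
  have pB : ∀ r : ℕ, ((r:ℝ)+1) * (2*N-4-4*b-4*r) ≠ 0 := fun r =>
    mul_ne_zero (by positivity) (hB r)
  have E1 : ∀ r t : ℕ, ((r:ℝ)+1) * (2*N-4-4*a-4*r) * c (r+1) t
    + ((k:ℝ)-r-t+1) * ((k:ℝ)-r-t) * (if t = 0 then 0 else c r (t-1))
    - ((k:ℝ)-r-t) * (4*t+2*((k:ℝ)-1-r-t)+2*b) * c r t = 0 := by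
    intro r t
    rw [hc r]
    dsimp only
    rw [mul_div_cancel₀ _ (pA r)]
    ring
  have z0 : ∀ t, k < t → c0 t = 0 := by
    intro t ht
    induction t with
    | zero => omega
    | succ t ih =>
      rw [h0]
      rcases Nat.lt_or_ge k t with h | h
      · rw [ih h]; simp
      · have : t = k := by omega
        subst this; simp
  have z : ∀ r t : ℕ, k < r + t → c r t = 0 := by
    intro r
    induction r with
    | zero => intro t ht; rw [hc0]; exact z0 t (by omega)
    | succ r ih =>
      intro t ht
      rw [hc]
      dsimp only
      rcases Nat.lt_or_ge k (r+t) with h | h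
      · rw [ih t h]
        by_cases h0 : t = 0
        · simp [h0]
        · rcases Nat.lt_or_ge k (r+(t-1)) with h2 | h2
          · rw [ih _ h2]; simp
          · have : (k:ℝ) = r + t - 1 := by
              have : k + 1 = r + t := by omega
              have : (k:ℝ) + 1 = r + t := by exact_mod_cast this
              linarith
            rw [this]
            have e : (r:ℝ) + t - 1 - r - t + 1 = 0 := by ring
            rw [e]; simp
      · have : (k:ℝ) = r + t := by
          have : k = r + t := by omega
          exact_mod_cast this
        rw [this]; simp
  refine ⟨c, by rw [hc0, h00], z, E1, ?_⟩
  intro r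
  induction r with
  | zero =>
    intro t
    rw [hc0, h0, mul_div_cancel₀ _ (pB t)]
    simp
  | succ r ih =>
    intro t
    apply (mul_eq_zero.1 _).resolve_left (pA r)
    have e1 := E1 r (t+1)
    have e2 := E1 r t
    have e3 := ih t
    rcases t with _ | t
    · rcases r with _ | r
      · simp [-mul_eq_zero] at e1 e2 e3 ⊢
        linear_combination (2*N-4-4*b) * e1 - ((k:ℝ)-1)*(2*((k:ℝ)-1)+2+2*a)*e2 +
          ((k:ℝ)-1)*(2*((k:ℝ)-1)+2+2*b) * e3
      · have e5 := E1 r 0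
        simp [-mul_eq_zero] at e1 e2 e3 e5 ⊢
        linear_combination (2*N-4-4*b) * e1 -
          ((k:ℝ)-1-(r+1))*(4*(r+1)+2+2*((k:ℝ)-1-(r+1))+2*a)*e2 +
          ((k:ℝ)-1-(r+1))*(2*((k:ℝ)-1-(r+1))+2+2*b) * e3 +
          ((k:ℝ)-1-(r+1))*((k:ℝ)-(r+1)) * e5
    · have e4 := ih t
      rcases r with _ | r
      · simp [-mul_eq_zero] at e1 e2 e3 e4 ⊢
        linear_combination ((t:ℝ)+2)*(2*N-4-4*b-4*(t+1)) * e1 -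
          ((k:ℝ)-1-(t+1))*(2*((k:ℝ)-1-(t+1))+2+2*a)*e2 +
          ((k:ℝ)-1-(t+1))*(4*(t+1)+2*((k:ℝ)-1-(t+1))+2+2*b) * e3
          - ((k:ℝ)-1-(t+1))*((k:ℝ)-(t+1)) * e4
      · have e5 := E1 r (t+1)
        simp [-mul_eq_zero] at e1 e2 e3 e4 e5 ⊢
        linear_combination ((t:ℝ)+2)*(2*N-4-4*b-4*(t+1)) * e1 -
          ((k:ℝ)-1-(r+1)-(t+1))*(4*(r+1)+2*((k:ℝ)-1-(r+1)-(t+1))+2+2*a)*e2 +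
          ((k:ℝ)-1-(r+1)-(t+1))*(4*(t+1)+2*((k:ℝ)-1-(r+1)-(t+1))+2+2*b) * e3
          - ((k:ℝ)-1-(r+1)-(t+1))*((k:ℝ)-(r+1)-(t+1)) * e4
          + ((k:ℝ)-1-(r+1)-(t+1))*((k:ℝ)-(r+1)-(t+1)) * e5

theorem closed_sys (k : ℕ) (N : ℝ) {Y : Type*} [TopologicalSpace Y] (u v : Y → ℝ)
    (c : Y → ℕ → ℕ → ℝ) (hu : Continuous u) (hv : Continuous v)
    (hcont : ∀ r t, Continuous fun y => c y r t) :
    IsClosed {y | SysE k N (u y) (v y) (c y)} := by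
  have hite : ∀ (p : Prop) [Decidable p] (r t : ℕ),
      Continuous fun x => if p then (0:ℝ) else c x r t := by
    intro p _ r t
    split_ifs
    · exact continuous_const
    · exact hcont r t
  have hSeq : {y | SysE k N (u y) (v y) (c y)} =
      (⋂ r, ⋂ t, ⋂ (_ : k < r + t), {x | c x r t = 0}) ∩
      ((⋂ r : ℕ, ⋂ t : ℕ, {x | ((r:ℝ)+1) * (2*N-4-4*(u x)-4*r) * c x (r+1) t
    + ((k:ℝ)-r-t+1) * ((k:ℝ)-r-t) * (if t = 0 then 0 else c x r (t-1))
    - ((k:ℝ)-r-t) * (4*t+2*((k:ℝ)-1-r-t)+2*(v x)) * c x r t = 0}) ∩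
      (⋂ r : ℕ, ⋂ t : ℕ, {x | ((t:ℝ)+1) * (2*N-4-4*(v x)-4*t) * c x r (t+1)
    + ((k:ℝ)-r-t+1) * ((k:ℝ)-r-t) * (if r = 0 then 0 else c x (r-1) t)
    - ((k:ℝ)-r-t) * (4*r+2*((k:ℝ)-1-r-t)+2*(u x)) * c x r t = 0})) := by
    ext x
    simp only [SysE, Set.mem_inter_iff, Set.mem_iInter]
    exact Iff.rfl
  rw [hSeq]
  refine IsClosed.inter ?_ (IsClosed.inter ?_ ?_)
  · refine isClosed_iInter fun r => isClosed_iInter fun t => isClosed_iInter fun _ => ?_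
    exact isClosed_eq (hcont r t) continuous_const
  · refine isClosed_iInter fun r => isClosed_iInter fun t => ?_
    have h1 := hcont (r+1) t
    have h2 := hcont r t
    have h3 := hite (t = 0) r (t-1)
    refine isClosed_eq (((Continuous.mul ?_ h1).add (continuous_const.mul h3)).sub
      (Continuous.mul ?_ h2)) continuous_const
    · fun_prop
    · fun_prop
  · refine isClosed_iInter fun r => isClosed_iInter fun t => ?_
    have h1 := hcont r (t+1)
    have h2 := hcont r t
    have h3 := hite (r = 0) (r-1) t
    refine isClosed_eq (((Continuous.mul ?_ h1).add (continuous_const.mul h3)).sub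
      (Continuous.mul ?_ h2)) continuous_const
    · fun_prop
    · fun_prop

theorem all_sol (k : ℕ) (N a b : ℝ) :
    ∃ c : ℕ → ℕ → ℝ, c ≠ 0 ∧ SysE k N a b c := by
  let nrm : (ℕ → ℕ → ℝ) → ℝ := fun c =>
    ∑ r ∈ Finset.range (k+1), ∑ t ∈ Finset.range (k+1), |c r t|
  have hnc : Continuous nrm := by
    apply continuous_finsetSum; intro r _
    apply continuous_finsetSum; intro t _
    fun_prop
  let K : Set (ℕ → ℕ → ℝ) := (Set.pi Set.univ fun _ => Set.pi Set.univ fun _ => Set.Icc (-1:ℝ) 1) ∩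
    {c | nrm c = 1}
  have hK : IsCompact K := by
    apply IsCompact.inter_right
    · exact isCompact_univ_pi fun _ => isCompact_univ_pi fun _ => isCompact_Icc
    · exact isClosed_eq hnc continuous_const
  have : CompactSpace K := isCompact_iff_compactSpace.1 hK
  let S : Set (ℝ × K) := {x | SysE k N (a + x.1) (b + x.1) x.2.1}
  have hS : IsClosed S := by
    refine closed_sys k N (fun x : ℝ × K => a + x.1) (fun x => b + x.1) (fun x => x.2.1)
      (by fun_prop) (by fun_prop) ?_
    intro r t
    exact (continuous_apply_apply r t).comp (continuous_subtype_val.comp continuous_snd)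
  have hT : IsClosed (Prod.fst '' S) := isClosedMap_fst_of_compactSpace S hS
  have hd : Dense (Prod.fst '' S) := by
    have hcount : (Set.range (fun r : ℕ => (2*N-4-4*a-4*(r:ℝ))/4) ∪
      Set.range (fun r : ℕ => (2*N-4-4*b-4*(r:ℝ))/4)).Countable :=
      (Set.countable_range _).union (Set.countable_range _)
    refine (hcount.dense_compl ℝ).mono ?_
    intro τ hτ
    simp only [Set.mem_compl_iff, Set.mem_union, Set.mem_range, not_or, not_exists] at hτ
    obtain ⟨c, hc1, z, E1, E2⟩ := gen_sol k N (a+τ) (b+τ)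
      (fun r h => hτ.1 r (by linarith)) (fun r h => hτ.2 r (by linarith))
    have hle : ∀ r t, |c r t| ≤ nrm c := by
      intro r t
      by_cases h : k < r + t
      · rw [z r t h, abs_zero]
        exact Finset.sum_nonneg fun _ _ => Finset.sum_nonneg fun _ _ => abs_nonneg _
      · calc |c r t| ≤ ∑ t ∈ Finset.range (k+1), |c r t| :=
              Finset.single_le_sum (f := fun t => |c r t|) (fun _ _ => abs_nonneg _)
                (Finset.mem_range.2 (by omega))
          _ ≤ nrm c := Finset.single_le_sum (f := fun r => ∑ t ∈ Finset.range (k+1), |c r t|)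
                (fun _ _ => Finset.sum_nonneg fun _ _ => abs_nonneg _)
                (Finset.mem_range.2 (by omega))
    have hpos : 0 < nrm c := by
      have := hle 0 0
      rw [hc1, abs_one] at this
      linarith
    let c' : ℕ → ℕ → ℝ := fun r t => (nrm c)⁻¹ * c r t
    have hc' : c' ∈ K := by
      constructor
      · intro r _ t _
        refine abs_le.1 ?_
        simp only [c', abs_mul, abs_inv, abs_of_pos hpos]
        rw [inv_mul_le_iff₀ hpos, mul_one]
        exact hle r t
      · change nrm c' = 1
        have : nrm c' = (nrm c)⁻¹ * nrm c := by
          simp only [nrm, c', abs_mul, ← Finset.mul_sum]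
          rw [abs_of_pos (inv_pos.2 hpos)]
        rw [this, inv_mul_cancel₀ hpos.ne']
    refine ⟨(τ, ⟨c', hc'⟩), ⟨?_, ?_, ?_⟩, rfl⟩
    · intro r t h
      simp [c', z r t h]
    · intro r t
      have e := E1 r t
      have hi : (if t = 0 then 0 else c' r (t-1)) = (nrm c)⁻¹ * (if t = 0 then 0 else c r (t-1)) := by
        split_ifs <;> simp [c']
      dsimp only
      rw [hi]
      simp only [c']
      linear_combination (nrm c)⁻¹ * e
    · intro r t
      have e := E2 r t
      have hi : (if r = 0 then 0 else c' (r-1) t) = (nrm c)⁻¹ * (if r = 0 then 0 else c (r-1) t) := by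
        split_ifs <;> simp [c']
      dsimp only
      rw [hi]
      simp only [c']
      linear_combination (nrm c)⁻¹ * e
  have h0 : (0:ℝ) ∈ Prod.fst '' S := by
    rw [← hT.closure_eq]; exact hd 0
  obtain ⟨⟨τ, c⟩, hc, h⟩ := h0
  simp only at h
  subst h
  refine ⟨c.1, ?_, by simpa [S] using hc⟩
  intro h
  have := c.2.2
  simp [nrm, h] at this

open MvPolynomial in
theorem exists_poly_coeff {σ : Type*} [Fintype σ] (k : ℕ) (w : (σ →₀ ℕ) → ℝ) :
    ∃ p : MvPolynomial σ ℝ, ∀ m, coeff m p = if ∑ i, m i = k then w m else 0 := by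
  classical
  refine ⟨∑ m ∈ Finset.finsuppAntidiag Finset.univ k, monomial m (w m), fun m => ?_⟩
  simp [coeff_sum, coeff_monomial, Finset.mem_finsuppAntidiag]

open MvPolynomial in
theorem coeff_X_mul_pderiv {σ : Type*} (i : σ) (q : MvPolynomial σ ℝ) (m : σ →₀ ℕ) :
    coeff m (X i * pderiv i q) = m i * coeff m q := by
  classical
  rw [coeff_X_mul']
  split_ifs with h
  · have h1 : m i ≠ 0 := by simpa using h
    have h2 : m - Finsupp.single i 1 + Finsupp.single i 1 = m :=
      tsub_add_cancel_of_le (by simpa using Nat.one_le_iff_ne_zero.2 h1)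
    rw [coeff_pderiv, h2, mul_comm]
    congr 1
    have : ((m - Finsupp.single i 1 : σ →₀ ℕ) i) + 1 = m i := by
      simp; omega
    exact_mod_cast this
  · have h1 : m i = 0 := by simpa using h
    simp [h1]

open MvPolynomial in
/-- the three-variable polynomial. -/
theorem exists_three (k : ℕ) (N a b : ℝ) :
    ∃ p : MvPolynomial (Fin 3) ℝ, p ≠ 0 ∧ p.IsHomogeneous k ∧
      C (2*N-4-4*a) * pderiv 0 p - C 4 * (X 0 * pderiv 0 (pderiv 0 p))
        + X 2 * pderiv 1 (pderiv 1 p) - C 4 * (X 2 * pderiv 2 (pderiv 1 p))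
        - C 2 * (X 1 * pderiv 1 (pderiv 1 p)) - C (2*b) * pderiv 1 p = 0 ∧
      C (2*N-4-4*b) * pderiv 2 p - C 4 * (X 2 * pderiv 2 (pderiv 2 p))
        + X 0 * pderiv 1 (pderiv 1 p) - C 4 * (X 0 * pderiv 0 (pderiv 1 p))
        - C 2 * (X 1 * pderiv 1 (pderiv 1 p)) - C (2*a) * pderiv 1 p = 0 := by
  obtain ⟨c, hc0, z, E1, E2⟩ := all_sol k N a b
  obtain ⟨p, hp⟩ := exists_poly_coeff (σ := Fin 3) k (fun m => c (m 0) (m 2))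
  simp only [Fin.sum_univ_three] at hp
  refine ⟨p, ?_, ?_, ?_, ?_⟩
  · rintro rfl
    apply hc0
    funext r t
    by_cases h : k < r + t
    · exact z r t h
    · have := hp (Finsupp.equivFunOnFinite.symm ![r, k - r - t, t])
      have hk : r + (k - r - t) + t = k := by omega
      have h2 : (0:ℝ) = if r + (k - r - t) + t = k then c r t else 0 := this
      rw [if_pos hk] at h2
      exact h2.symm
  · intro m hm
    rw [hp] at hm
    have : m 0 + m 1 + m 2 = k := by
      by_contra h
      simp [h] at hm
    rw [← this]
    simp [Finsupp.weight_apply, Finsupp.sum_fintype, Fin.sum_univ_three]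
  · ext m
    simp only [coeff_add, coeff_sub, coeff_C_mul, coeff_X_mul_pderiv, coeff_zero]
    simp only [coeff_X_mul', Finsupp.mem_support_iff, coeff_pderiv, hp, Finsupp.add_apply]
    simp [-mul_eq_zero]
    have e1 := E1 (m 0) (m 2)
    generalize m 0 = r at *
    generalize m 1 = s at *
    generalize m 2 = t at *
    by_cases h : r + s + t + 1 = k
    · have hk : (k:ℝ) = r + s + t + 1 := by exact_mod_cast h.symm
      rw [hk] at e1
      by_cases ht : t = 0
      · rw [if_pos ht] at e1 ⊢
        rw [if_pos (by omega), if_pos (by omega),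
          if_pos (by omega), if_pos (by omega), if_pos (by omega)]
        linear_combination e1
      · rw [if_neg ht] at e1 ⊢
        rw [if_pos (by omega), if_pos (by omega), if_pos (by omega),
          if_pos (by omega), if_pos (by omega), if_pos (by omega)]
        linear_combination e1
    · by_cases ht : t = 0
      · rw [if_pos ht, if_neg (by omega), if_neg (by omega),
          if_neg (by omega), if_neg (by omega), if_neg (by omega)]
        simp
      · rw [if_neg ht, if_neg (by omega), if_neg (by omega), if_neg (by omega),
          if_neg (by omega), if_neg (by omega), if_neg (by omega)]
        simp
  · ext m
    simp only [coeff_add, coeff_sub, coeff_C_mul, coeff_X_mul_pderiv, coeff_zero]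
    simp only [coeff_X_mul', Finsupp.mem_support_iff, coeff_pderiv, hp, Finsupp.add_apply]
    simp [-mul_eq_zero]
    have e1 := E2 (m 0) (m 2)
    generalize m 0 = r at *
    generalize m 1 = s at *
    generalize m 2 = t at *
    by_cases h : r + s + t + 1 = k
    · have hk : (k:ℝ) = r + s + t + 1 := by exact_mod_cast h.symm
      rw [hk] at e1
      by_cases ht : r = 0
      · rw [if_pos ht] at e1 ⊢
        rw [if_pos (by omega), if_pos (by omega),
          if_pos (by omega), if_pos (by omega), if_pos (by omega)]
        linear_combination e1
      · rw [if_neg ht] at e1 ⊢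
        rw [if_pos (by omega), if_pos (by omega), if_pos (by omega),
          if_pos (by omega), if_pos (by omega), if_pos (by omega)]
        linear_combination e1
    · by_cases ht : r = 0
      · rw [if_pos ht, if_neg (by omega), if_neg (by omega),
          if_neg (by omega), if_neg (by omega), if_neg (by omega)]
        simp
      · rw [if_neg ht, if_neg (by omega), if_neg (by omega), if_neg (by omega),
          if_neg (by omega), if_neg (by omega), if_neg (by omega)]
        simp

open MvPolynomial in
/-- First-order (rotation) part acting on symbols. -/
noncomputable def rotE {n : ℕ} {σ : Type*} (s : Fin n → σ) (e : Fin n → ℝ) (i j : Fin n)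
    (P : MvPolynomial σ ℝ) : MvPolynomial σ ℝ :=
  C (e j) * (X (s i) * pderiv (s j) P) - C (e i) * (X (s j) * pderiv (s i) P)

open MvPolynomial in
/-- Second-order (inversion) part acting on symbols. -/
noncomputable def invE {n : ℕ} {σ : Type*} (s : Fin n → σ) (e : Fin n → ℝ) (a : ℝ) (i : Fin n)
    (P : MvPolynomial σ ℝ) : MvPolynomial σ ℝ :=
  X (s i) * ∑ j, C (e j) * pderiv (s j) (pderiv (s j) P)
    - C (2 * e i) * ∑ j, X (s j) * pderiv (s j) (pderiv (s i) P)
    - C (2 * a * e i) * pderiv (s i) P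

/-- The conditions on a symbol which ensure invariance. -/
def GoodSymbol {n : ℕ} (e : Fin n → ℝ) (k : ℕ) (a b : ℝ)
    (P : MvPolynomial (Fin n ⊕ Fin n) ℝ) : Prop :=
  P.IsHomogeneous (2 * k) ∧
  (∀ i j, rotE Sum.inl e i j P + rotE Sum.inr e i j P = 0) ∧
  (∀ i, invE Sum.inl e a i P + invE Sum.inr e b i P = 0)

open MvPolynomial in
theorem derivation_aeval {τ B : Type*} [Fintype τ] [CommRing B] [Algebra ℝ B] (D : Derivation ℝ B B)
    (v : τ → B) (q : MvPolynomial τ ℝ) :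
    D (aeval v q) = ∑ a, aeval v (pderiv a q) * D (v a) := by
  classical
  induction q using MvPolynomial.induction_on with
  | C r => simp
  | add p q hp hq => simp [hp, hq, add_mul, Finset.sum_add_distrib]
  | mul_X p i hp =>
    simp only [map_mul, aeval_X, Derivation.leibniz, hp, smul_eq_mul, map_add, pderiv_X, add_mul,
      Finset.sum_add_distrib]
    congr 1
    · rw [Finset.sum_eq_single i]
      · simp
      · intro b _ hb; simp [hb.symm]
      · simp
    · rw [Finset.mul_sum]; refine Finset.sum_congr rfl fun a _ => ?_; ring

open MvPolynomial in
theorem half_inv {n : ℕ} {σ : Type*} (s s' : Fin n → σ) (hs : Function.Injective s)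
    (hss : ∀ i j, s i ≠ s' j)
    (e : Fin n → ℝ) (he : ∀ i, e i * e i = 1) (a : ℝ)
    (v : Fin 3 → MvPolynomial σ ℝ) (u w : Fin 3)
    (hu : v u = ∑ j, C (e j) * (X (s j) * X (s j)))
    (h1 : v 1 = ∑ j, C (e j) * (X (s j) * X (s' j)))
    (hw : v w = ∑ j, C (e j) * (X (s' j) * X (s' j)))
    (hch : ∀ (q : MvPolynomial (Fin 3) ℝ) i, pderiv (s i) (aeval v q) = C 2 * C (e i) * X (s i) * aeval v (pderiv u q)
      + C (e i) * X (s' i) * aeval v (pderiv 1 q)) (p : MvPolynomial (Fin 3) ℝ) (i : Fin n) :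
    invE s e a i (aeval v p) =
      X (s i) * aeval v (C (2*n-4-4*a) * pderiv u p - C 4 * (X u * pderiv u (pderiv u p))
        + X w * pderiv 1 (pderiv 1 p)) +
      X (s' i) * aeval v (- C 4 * (X u * pderiv u (pderiv 1 p))
        - C 2 * (X 1 * pderiv 1 (pderiv 1 p)) - C (2*a) * pderiv 1 p) := by
  classical
  have hE : ∀ j, (C (e j) : MvPolynomial σ ℝ) * C (e j) = 1 := fun j => by
    rw [← C_mul, he, C_1]
  have hcomm : pderiv 1 (pderiv u p) = pderiv u (pderiv 1 p) := by
    ext m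
    simp only [coeff_pderiv, Finsupp.add_apply]
    by_cases h : u = 1
    · subst h; rfl
    · rw [add_right_comm]; simp [h, Ne.symm h]; ring
  have hd2 : ∀ i j, pderiv (s j) (pderiv (s i) (aeval v p)) =
      (if i = j then C 2 * C (e i) * aeval v (pderiv u p) else 0) +
      C 4 * C (e i) * C (e j) * X (s i) * X (s j) * aeval v (pderiv u (pderiv u p)) +
      C 2 * C (e i) * C (e j) * (X (s i) * X (s' j) + X (s j) * X (s' i)) *
        aeval v (pderiv u (pderiv 1 p)) +
      C (e i) * C (e j) * X (s' i) * X (s' j) * aeval v (pderiv 1 (pderiv 1 p)) := by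
    intro i j
    have hx : pderiv (s j) (X (s i) : MvPolynomial σ ℝ) = if i = j then 1 else 0 := by
      rw [pderiv_X, Pi.single_apply]
      simp [hs.eq_iff]
    have hx' : pderiv (s j) (X (s' i) : MvPolynomial σ ℝ) = 0 :=
      pderiv_X_of_ne (hss j i).symm
    have h4 : (C 4 : MvPolynomial σ ℝ) = C 2 * C 2 := by rw [← C_mul]; norm_num
    rw [hch, map_add]
    simp only [Derivation.leibniz, hch, hx, hx', pderiv_C, hcomm, smul_eq_mul, h4]
    split_ifs <;> ring
  have hlap : ∑ j, C (e j) * pderiv (s j) (pderiv (s j) (aeval v p)) =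
      C 2 * C (n:ℝ) * aeval v (pderiv u p) + C 4 * v u * aeval v (pderiv u (pderiv u p)) +
      C 4 * v 1 * aeval v (pderiv u (pderiv 1 p)) + v w * aeval v (pderiv 1 (pderiv 1 p)) := by
    have h4 : (C 4 : MvPolynomial σ ℝ) = C 2 * 2 := by
      rw [show (2 : MvPolynomial σ ℝ) = C 2 from rfl, ← C_mul]; norm_num
    have : ∀ j, C (e j) * pderiv (s j) (pderiv (s j) (aeval v p)) =
        C 2 * aeval v (pderiv u p) +
        C 4 * aeval v (pderiv u (pderiv u p)) * (C (e j) * (X (s j) * X (s j))) +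
        C 4 * aeval v (pderiv u (pderiv 1 p)) * (C (e j) * (X (s j) * X (s' j))) +
        aeval v (pderiv 1 (pderiv 1 p)) * (C (e j) * (X (s' j) * X (s' j))) := by
      intro j
      rw [hd2, if_pos rfl]
      have h := hE j
      linear_combination (exp := 1) (C 2 * aeval v (pderiv u p) +
        C 4 * aeval v (pderiv u (pderiv u p)) * (C (e j) * (X (s j) * X (s j))) +
        C 4 * aeval v (pderiv u (pderiv 1 p)) * (C (e j) * (X (s j) * X (s' j))) +
        aeval v (pderiv 1 (pderiv 1 p)) * (C (e j) * (X (s' j) * X (s' j)))) * h - 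
        (C (e j))^3 * aeval v (pderiv u (pderiv 1 p)) * (X (s j) * X (s' j)) * h4
    rw [Finset.sum_congr rfl fun j _ => this j]
    simp only [Finset.sum_add_distrib, ← Finset.mul_sum, ← hu, ← h1, ← hw]
    simp
    ring
  have heul : ∑ j, X (s j) * pderiv (s j) (pderiv (s i) (aeval v p)) =
      C 2 * C (e i) * X (s i) * aeval v (pderiv u p) +
      C 4 * C (e i) * X (s i) * v u * aeval v (pderiv u (pderiv u p)) +
      C 2 * C (e i) * (X (s i) * v 1 + X (s' i) * v u) * aeval v (pderiv u (pderiv 1 p)) +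
      C (e i) * X (s' i) * v 1 * aeval v (pderiv 1 (pderiv 1 p)) := by
    have : ∀ j, X (s j) * pderiv (s j) (pderiv (s i) (aeval v p)) =
        (if i = j then X (s j) * (C 2 * C (e i) * aeval v (pderiv u p)) else 0) +
        (C 4 * C (e i) * X (s i) * aeval v (pderiv u (pderiv u p)) +
         C 2 * C (e i) * X (s' i) * aeval v (pderiv u (pderiv 1 p)))
          * (C (e j) * (X (s j) * X (s j))) +
        (C 2 * C (e i) * X (s i) * aeval v (pderiv u (pderiv 1 p)) +
          C (e i) * X (s' i) * aeval v (pderiv 1 (pderiv 1 p)))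
         * (C (e j) * (X (s j) * X (s' j))) := by
      intro j
      rw [hd2]
      split_ifs <;> ring
    rw [Finset.sum_congr rfl fun j _ => this j]
    simp only [Finset.sum_add_distrib, ← Finset.mul_sum, ← hu, ← h1]
    simp
    ring
  unfold invE
  rw [hlap, heul, hch]
  have h := hE i
  simp only [map_add, map_sub, map_mul, map_neg, aeval_X, aeval_C, algebraMap_eq]
  have h4 : (C 4 : MvPolynomial σ ℝ) = 4 := rfl
  have h2 : (C 2 : MvPolynomial σ ℝ) = 2 := rfl
  rw [h4, h2]
  generalize (C (e i) : MvPolynomial σ ℝ) = E at *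
  linear_combination (- (4 * X (s i) * aeval v (pderiv u p) +
      8 * X (s i) * v u * aeval v (pderiv u (pderiv u p)) +
      4 * (X (s i) * v 1 + X (s' i) * v u) * aeval v (pderiv u (pderiv 1 p)) +
      2 * X (s' i) * v 1 * aeval v (pderiv 1 (pderiv 1 p))) 
      - C a * 2 * (2 * X (s i) * aeval v (pderiv u p) + X (s' i) * aeval v (pderiv 1 p))) * h

open MvPolynomial in
theorem eval_aeval_comp {σ τ : Type*} (pt : σ → ℝ) (v : τ → MvPolynomial σ ℝ)
    (p : MvPolynomial τ ℝ) :
    eval pt (aeval v p) = eval (fun a => eval pt (v a)) p := by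
  induction p using MvPolynomial.induction_on with
  | C r => simp
  | add p q hp hq => rw [map_add, map_add, map_add, hp, hq]
  | mul_X p i hp => rw [map_mul, map_mul, map_mul, hp, aeval_X, eval_X]

open MvPolynomial in
/-- The three basic invariants. -/
noncomputable def basicInv {n : ℕ} (e : Fin n → ℝ) : Fin 3 → MvPolynomial (Fin n ⊕ Fin n) ℝ :=
  ![∑ j, C (e j) * (X (Sum.inl j) * X (Sum.inl j)),
    ∑ j, C (e j) * (X (Sum.inl j) * X (Sum.inr j)),
    ∑ j, C (e j) * (X (Sum.inr j) * X (Sum.inr j))]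

open MvPolynomial in
theorem chain_inl {n : ℕ} (e : Fin n → ℝ) (q : MvPolynomial (Fin 3) ℝ) (i : Fin n) :
    pderiv (Sum.inl i) (aeval (basicInv e) q) =
      C 2 * C (e i) * X (Sum.inl i) * aeval (basicInv e) (pderiv 0 q)
      + C (e i) * X (Sum.inr i) * aeval (basicInv e) (pderiv 1 q) := by
  classical
  rw [derivation_aeval, Fin.sum_univ_three]
  have h2 : (C 2 : MvPolynomial (Fin n ⊕ Fin n) ℝ) = 2 := rfl
  have h0 : pderiv (Sum.inl i) (basicInv e 0) = C 2 * C (e i) * X (Sum.inl i) := by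
    simp only [basicInv, Matrix.cons_val, map_sum, Derivation.leibniz, pderiv_C, pderiv_X,
      smul_eq_mul]
    rw [Finset.sum_eq_single i]
    · simp [h2]; ring
    · intro j _ hj; simp [hj.symm]
    · simp
  have h1 : pderiv (Sum.inl i) (basicInv e 1) = C (e i) * X (Sum.inr i) := by
    simp only [basicInv, Matrix.cons_val, map_sum, Derivation.leibniz, pderiv_C, pderiv_X,
      smul_eq_mul]
    rw [Finset.sum_eq_single i]
    · simp
    · intro j _ hj; simp [hj.symm]
    · simp
  have h3 : pderiv (Sum.inl i) (basicInv e 2) = 0 := by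
    simp [basicInv, Derivation.leibniz, pderiv_X]
  rw [h0, h1, h3]
  ring

open MvPolynomial in
theorem chain_inr {n : ℕ} (e : Fin n → ℝ) (q : MvPolynomial (Fin 3) ℝ) (i : Fin n) :
    pderiv (Sum.inr i) (aeval (basicInv e) q) =
      C 2 * C (e i) * X (Sum.inr i) * aeval (basicInv e) (pderiv 2 q)
      + C (e i) * X (Sum.inl i) * aeval (basicInv e) (pderiv 1 q) := by
  classical
  rw [derivation_aeval, Fin.sum_univ_three]
  have h2 : (C 2 : MvPolynomial (Fin n ⊕ Fin n) ℝ) = 2 := rfl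
  have h0 : pderiv (Sum.inr i) (basicInv e 2) = C 2 * C (e i) * X (Sum.inr i) := by
    simp only [basicInv, Matrix.cons_val, map_sum, Derivation.leibniz, pderiv_C, pderiv_X,
      smul_eq_mul]
    rw [Finset.sum_eq_single i]
    · simp [h2]; ring
    · intro j _ hj; simp [hj.symm]
    · simp
  have h1 : pderiv (Sum.inr i) (basicInv e 1) = C (e i) * X (Sum.inl i) := by
    simp only [basicInv, Matrix.cons_val, map_sum, Derivation.leibniz, pderiv_C, pderiv_X,
      smul_eq_mul]
    rw [Finset.sum_eq_single i]
    · simp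
    · intro j _ hj; simp [hj.symm]
    · simp
  have h3 : pderiv (Sum.inr i) (basicInv e 0) = 0 := by
    simp [basicInv, Derivation.leibniz, pderiv_X]
  rw [h0, h1, h3]
  ring

open MvPolynomial in
theorem basicInv_indep {n : ℕ} (hn : 2 ≤ n) (e : Fin n → ℝ) (he : ∀ i, e i * e i = 1)
    (p : MvPolynomial (Fin 3) ℝ) (hp : aeval (basicInv e) p = 0) : p = 0 := by
  classical
  let i0 : Fin n := ⟨0, by omega⟩
  let i1 : Fin n := ⟨1, by omega⟩
  have h01 : i0 ≠ i1 := by simp [i0, i1]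
  have habs : ∀ i, |e i| = 1 := fun i => by
    have := he i
    rcases mul_self_eq_one_iff.1 this with h | h <;> simp [h]
  apply MvPolynomial.funext_set (fun a => (fun y => (![e i0, 1, e i1] : Fin 3 → ℝ) a * y) ''
    Set.Ioo ((![1, 0, 2] : Fin 3 → ℝ) a) ((![2, 1, 3] : Fin 3 → ℝ) a))
  · intro a
    apply Set.Infinite.image
    · intro y _ y' _ h
      have h0 : (![e i0, 1, e i1] : Fin 3 → ℝ) a ≠ 0 := by
        have q0 : e i0 ≠ 0 := fun h => by simpa [h] using he i0
        have q1 : e i1 ≠ 0 := fun h => by simpa [h] using he i1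
        fin_cases a <;> simp [q0, q1]
      exact mul_left_cancel₀ h0 h
    · apply Set.Ioo_infinite
      fin_cases a <;> norm_num
  · intro x hx
    have hx0 := hx 0 trivial
    have hx1 := hx 1 trivial
    have hx2 := hx 2 trivial
    simp at hx0 hx1 hx2
    obtain ⟨A, ⟨hA1, hA2⟩, hA⟩ := hx0
    obtain ⟨T, ⟨hT1, hT2⟩, hT⟩ := hx2
    have hApos : 0 < A := by linarith
    -- the point
    let r := Real.sqrt A
    have hr : r * r = A := Real.mul_self_sqrt hApos.le
    have hr0 : r ≠ 0 := by
      intro h; rw [h] at hr; linarith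
    let y := e i0 * x 1 / r
    have hy2 : y * y = x 1 ^ 2 / A := by
      simp only [y]
      rw [← hr]
      field_simp
      linear_combination (x 1)^2 * he i0
    have hy1 : y * y ≤ 1 := by
      rw [hy2, div_le_one hApos]; nlinarith
    have hz0 : 0 ≤ T - e i1 * e i0 * (y * y) := by
      have : |e i1 * e i0 * (y * y)| ≤ 1 := by
        rw [abs_mul, abs_mul, habs, habs, abs_of_nonneg (mul_self_nonneg y)]; linarith
      have := abs_le.1 this
      linarith
    let z := Real.sqrt (T - e i1 * e i0 * (y * y))
    have hz : z * z = T - e i1 * e i0 * (y * y) := Real.mul_self_sqrt hz0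
    let pt : Fin n ⊕ Fin n → ℝ := Sum.elim (Pi.single i0 r) (Pi.single i0 y + Pi.single i1 z)
    have hsum : ∀ F : Fin n → ℝ, (∀ i, i ≠ i0 → i ≠ i1 → F i = 0) → ∑ i, F i = F i0 + F i1 := by
      intro F hF
      rw [← Finset.sum_pair h01]
      symm
      apply Finset.sum_subset (Finset.subset_univ _)
      intro i _ hi
      simp at hi
      exact hF i hi.1 hi.2
    have hev := congrArg (eval pt) hp
    have hcomp : eval pt (aeval (basicInv e) p) = eval (fun a => eval pt (basicInv e a)) p := by
      exact eval_aeval_comp _ _ _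
    rw [hcomp] at hev
    have hxe : (fun a => eval pt (basicInv e a)) = x := by
      funext a
      have z0 : ∀ i, i ≠ i0 → i ≠ i1 → (Pi.single i0 r : Fin n → ℝ) i = 0 := by
        intro i h _; simp [h]
      have z1 : ∀ i, i ≠ i0 → i ≠ i1 → (Pi.single i0 y + Pi.single i1 z : Fin n → ℝ) i = 0 := by
        intro i h h'; simp [h, h']
      fin_cases a
      · simp only [basicInv, Matrix.cons_val, map_sum, map_mul, eval_C, eval_X, pt, Sum.elim_inl]
        simp
        rw [hsum _ (fun i h h' => by rw [z0 i h h']; simp)]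
        simp [h01, h01.symm, hr, hA]
      · simp only [basicInv, Matrix.cons_val, map_sum, map_mul, eval_C, eval_X, pt, Sum.elim_inl,
          Sum.elim_inr]
        simp
        rw [hsum _ (fun i h h' => by rw [z0 i h h']; simp)]
        simp [h01, h01.symm]
        simp only [y]
        field_simp
        linear_combination (x 1) * he i0
      · simp only [basicInv, Matrix.cons_val, map_sum, map_mul, eval_C, eval_X, pt,
          Sum.elim_inr]
        simp
        rw [hsum _ (fun i h h' => by have := z1 i h h'; simp at this; rw [this]; simp)]
        simp [h01, h01.symm, hz]
        rw [← hT]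
        linear_combination (- e i0 * (y * y)) * he i1
    rw [hxe] at hev
    simpa using hev

open MvPolynomial in
theorem exists_good_ge_two {n : ℕ} (hn : 2 ≤ n) (e : Fin n → ℝ) (he : ∀ i, e i * e i = 1)
    (k : ℕ) (a b : ℝ) : ∃ P, P ≠ 0 ∧ GoodSymbol e k a b P := by
  obtain ⟨p, hp0, hph, h1, h2⟩ := exists_three k n a b
  refine ⟨aeval (basicInv e) p, fun h => hp0 (basicInv_indep hn e he p h), ?_, ?_, ?_⟩
  · apply hph.aeval
    intro i
    have : ∀ s t : Fin n → Fin n ⊕ Fin n, (∑ j, C (e j) * (X (s j) * X (t j)) :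
        MvPolynomial (Fin n ⊕ Fin n) ℝ).IsHomogeneous 2 := by
      intro s t
      apply IsHomogeneous.sum
      intro j _
      have := (isHomogeneous_C (Fin n ⊕ Fin n) (e j)).mul
        ((isHomogeneous_X ℝ (s j)).mul (isHomogeneous_X ℝ (t j)))
      simpa using this
    fin_cases i <;> exact this _ _
  · intro i j
    simp only [rotE, chain_inl, chain_inr]
    have hE : ∀ j, (C (e j) : MvPolynomial (Fin n ⊕ Fin n) ℝ) * C (e j) = 1 := fun j => by
      rw [← C_mul, he, C_1]
    linear_combination (C 2 * X (Sum.inl i) * X (Sum.inl j) * aeval (basicInv e) (pderiv 0 p)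
      + (X (Sum.inl i) * X (Sum.inr j) + X (Sum.inl j) * X (Sum.inr i)) *
        aeval (basicInv e) (pderiv 1 p)
      + C 2 * X (Sum.inr i) * X (Sum.inr j) * aeval (basicInv e) (pderiv 2 p)) * (hE j - hE i)
  · intro i
    rw [half_inv Sum.inl Sum.inr Sum.inl_injective (by simp) e he a (basicInv e) 0 2 rfl rfl rfl
        (chain_inl e),
      half_inv Sum.inr Sum.inl Sum.inr_injective (by simp) e he b (basicInv e) 2 0 rfl
        (by simp [basicInv, mul_comm]) rfl (chain_inr e)]
    have h1 := congrArg (aeval (basicInv e)) h1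
    have h2 := congrArg (aeval (basicInv e)) h2
    simp only [map_add, map_sub, map_neg, map_zero, neg_mul] at h1 h2 ⊢
    linear_combination X (Sum.inl i) * h1 + X (Sum.inr i) * h2

theorem two_term (u w : ℕ → ℝ) (N : ℕ) :
    ∃ c : ℕ → ℝ, (∃ i ≤ N, c i ≠ 0) ∧ ∀ i < N, u i * c (i+1) + w i * c i = 0 := by
  induction N with
  | zero => exact ⟨fun _ => 1, ⟨0, le_rfl, by simp⟩, by simp⟩
  | succ N ih =>
    by_cases hu : u N = 0
    · refine ⟨fun i => if i = N + 1 then 1 else 0, ⟨N+1, le_rfl, by simp⟩, ?_⟩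
      intro i hi
      rcases Nat.lt_or_ge i N with h | h
      · simp [show i ≠ N by omega, show i ≠ N + 1 by omega]
      · have : i = N := by omega
        subst this; simp [hu]
    · obtain ⟨c, ⟨i, hi, hci⟩, hc⟩ := ih
      refine ⟨fun i => if i = N + 1 then - (w N * c N) / u N else c i,
        ⟨i, by omega, by simpa [show i ≠ N + 1 by omega] using hci⟩, ?_⟩
      intro i hi
      rcases Nat.lt_or_ge i N with h | h
      · simpa [show i ≠ N by omega, show i ≠ N + 1 by omega] using hc i h
      · have : i = N := by omega
        subst this
        simp
        field_simp
        ring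

open MvPolynomial in
theorem exists_good_one (e : Fin 1 → ℝ)
    (k : ℕ) (a b : ℝ) : ∃ P, P ≠ 0 ∧ GoodSymbol e k a b P := by
  obtain ⟨c, ⟨i, hi, hci⟩, hc⟩ := two_term (fun i => ((i:ℝ)+1) * (i+2*a))
    (fun i => ((2*k:ℝ)-i) * ((2*k:ℝ)-1-i+2*b)) (2*k)
  obtain ⟨P, hP⟩ := exists_poly_coeff (σ := Fin 1 ⊕ Fin 1) (2*k) (fun m => c (m (Sum.inl 0)))
  simp at hP
  refine ⟨P, ?_, ?_, ?_, ?_⟩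
  · rintro rfl
    apply hci
    have := hP (Finsupp.equivFunOnFinite.symm (Sum.elim (fun _ => i) (fun _ => 2*k-i)))
    have h2 : (0:ℝ) = if i + (2*k-i) = 2*k then c i else 0 := this
    rw [if_pos (by omega)] at h2
    exact h2.symm
  · intro m hm
    rw [hP] at hm
    have : m (Sum.inl 0) + m (Sum.inr 0) = 2 * k := by
      by_contra h
      simp [h] at hm
    rw [← this]
    simp [Finsupp.weight_apply, Finsupp.sum_fintype]
  · intro i j
    have : i = j := Subsingleton.elim _ _
    subst this
    simp [rotE]
  · intro i
    have : i = 0 := Subsingleton.elim _ _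
    subst this
    have key : X (Sum.inl 0) * pderiv (Sum.inl 0) (pderiv (Sum.inl 0) P) +
        C (2 * a) * pderiv (Sum.inl 0) P +
        (X (Sum.inr 0) * pderiv (Sum.inr 0) (pderiv (Sum.inr 0) P) +
        C (2 * b) * pderiv (Sum.inr 0) P) = 0 := by
      ext m
      simp only [coeff_add, coeff_C_mul, coeff_X_mul_pderiv, coeff_zero]
      simp only [coeff_pderiv, hP, Finsupp.add_apply]
      simp [-mul_eq_zero]
      have h := hc (m (Sum.inl 0))
      generalize m (Sum.inl 0) = r at *
      generalize m (Sum.inr 0) = t at *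
      by_cases hk : r + t + 1 = 2 * k
      · have h := h (by omega)
        have hk' : (2*k:ℝ) = r + t + 1 := by exact_mod_cast hk.symm
        rw [if_pos (by omega), if_pos (by omega), if_pos (by omega), if_pos (by omega)]
        rw [hk'] at h
        linear_combination h
      · rw [if_neg (by omega), if_neg (by omega), if_neg (by omega), if_neg (by omega)]
        simp
    simp only [invE, Finset.univ_unique, Finset.sum_singleton, Fin.default_eq_zero, C_mul]
    rw [C_mul, C_mul] at key
    have h2 : (C 2 : MvPolynomial (Fin 1 ⊕ Fin 1) ℝ) = 2 := rfl
    rw [h2] at key ⊢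
    linear_combination (- C (e 0)) * key

/-- Iterated derivation along a multi-index. -/
noncomputable def DI {n : ℕ} {A : Type*} [CommRing A] [Algebra ℝ A] (D : Fin n → Derivation ℝ A A)
    (α : Fin n → ℕ) : Module.End ℝ A :=
  ((List.finRange n).map fun i => ((D i : A →ₗ[ℝ] A) : Module.End ℝ A) ^ (α i)).prod

theorem list_prod_pow_add {ι M : Type*} [Monoid M] (d : ι → M) (hd : ∀ i j, Commute (d i) (d j))
    (α β : ι → ℕ) (L : List ι) :
    (L.map fun i => d i ^ (α i + β i)).prod =
      (L.map fun i => d i ^ α i).prod * (L.map fun i => d i ^ β i).prod := by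
  induction L with
  | nil => simp
  | cons i L ih =>
    rw [List.map_cons, List.prod_cons, ih, List.map_cons, List.prod_cons, List.map_cons,
      List.prod_cons, pow_add]
    have h : Commute (d i ^ β i) (L.map fun i => d i ^ α i).prod := by
      apply Commute.list_prod_right
      intro y hy
      obtain ⟨j, _, rfl⟩ := List.mem_map.1 hy
      exact (hd i j).pow_pow _ _
    rw [mul_assoc, ← mul_assoc (d i ^ β i), h.eq]
    simp only [mul_assoc]

theorem DI_add {n : ℕ} {A : Type*} [CommRing A] [Algebra ℝ A] (D : Fin n → Derivation ℝ A A)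
    (hD : ∀ i j f, D i (D j f) = D j (D i f)) (α β : Fin n → ℕ) (f : A) :
    DI D (α + β) f = DI D α (DI D β f) := by
  have := list_prod_pow_add (fun i => ((D i : A →ₗ[ℝ] A) : Module.End ℝ A))
    (fun i j => by ext f; exact hD i j f) α β (List.finRange n)
  exact congrArg (fun F : Module.End ℝ A => F f) this

theorem DI_single {n : ℕ} {A : Type*} [CommRing A] [Algebra ℝ A] (D : Fin n → Derivation ℝ A A)
    (i : Fin n) (f : A) : DI D (Pi.single i 1) f = D i f := by
  unfold DI
  rw [List.prod_map_eq_pow_single i]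
  · rw [List.count_eq_one_of_mem (List.nodup_finRange n) (List.mem_finRange i)]
    simp
  · intro j hj _
    simp [hj]

theorem DI_zero {n : ℕ} {A : Type*} [CommRing A] [Algebra ℝ A] (D : Fin n → Derivation ℝ A A)
    (f : A) : DI D 0 f = f := by
  simp [DI]

open MvPolynomial in
/-- The bilinear operator with a given symbol. -/
noncomputable def Op {n : ℕ} {A : Type*} [CommRing A] [Algebra ℝ A] (D : Fin n → Derivation ℝ A A) :
    MvPolynomial (Fin n ⊕ Fin n) ℝ →ₗ[ℝ] A →ₗ[ℝ] A →ₗ[ℝ] A :=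
  (basisMonomials (Fin n ⊕ Fin n) ℝ).constr ℝ (fun m =>
    (LinearMap.mul ℝ A).compl₁₂ (DI D (fun i => m (Sum.inl i))) (DI D (fun i => m (Sum.inr i))))

open MvPolynomial in
theorem Op_monomial {n : ℕ} {A : Type*} [CommRing A] [Algebra ℝ A] (D : Fin n → Derivation ℝ A A)
    (m : Fin n ⊕ Fin n →₀ ℕ) (r : ℝ) (f g : A) :
    Op D (monomial m r) f g =
      r • (DI D (fun i => m (Sum.inl i)) f * DI D (fun i => m (Sum.inr i)) g) := by
  have h : (monomial m r : MvPolynomial (Fin n ⊕ Fin n) ℝ) =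
      r • basisMonomials (Fin n ⊕ Fin n) ℝ m := by
    simp [smul_monomial]
  rw [h, map_smul]
  unfold Op
  rw [Module.Basis.constr_basis]
  simp

open MvPolynomial in
theorem Op_X_inl {n : ℕ} {A : Type*} [CommRing A] [Algebra ℝ A] (D : Fin n → Derivation ℝ A A)
    (hD : ∀ i j f, D i (D j f) = D j (D i f)) (i : Fin n)
    (P : MvPolynomial (Fin n ⊕ Fin n) ℝ) (f g : A) :
    Op D (X (Sum.inl i) * P) f g = Op D P (D i f) g := by
  induction P using MvPolynomial.induction_on' with
  | add p q hp hq => simp [mul_add, hp, hq]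
  | monomial m r =>
    rw [X, monomial_mul, Op_monomial, Op_monomial, one_mul, ← DI_single D i, ← DI_add D hD]
    congr 3
    · congr 1
      funext j
      simp [Finsupp.single_apply, Pi.single_apply, add_comm, eq_comm]
    · congr 1
      funext j
      simp

open MvPolynomial in
theorem Op_X_inr {n : ℕ} {A : Type*} [CommRing A] [Algebra ℝ A] (D : Fin n → Derivation ℝ A A)
    (hD : ∀ i j f, D i (D j f) = D j (D i f)) (i : Fin n)
    (P : MvPolynomial (Fin n ⊕ Fin n) ℝ) (f g : A) :
    Op D (X (Sum.inr i) * P) f g = Op D P f (D i g) := by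
  induction P using MvPolynomial.induction_on' with
  | add p q hp hq => simp [mul_add, hp, hq]
  | monomial m r =>
    rw [X, monomial_mul, Op_monomial, Op_monomial, one_mul, ← DI_single D i, ← DI_add D hD]
    congr 3
    · congr 1
      funext j
      simp
    · congr 1
      funext j
      simp [Finsupp.single_apply, Pi.single_apply, add_comm, eq_comm]

open MvPolynomial in
theorem Op_C {n : ℕ} {A : Type*} [CommRing A] [Algebra ℝ A] (D : Fin n → Derivation ℝ A A)
    (r : ℝ) (f g : A) : Op D (C r) f g = r • (f * g) := by
  rw [← monomial_zero', Op_monomial]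
  have h : (fun i : Fin n => (0 : Fin n ⊕ Fin n →₀ ℕ) (Sum.inl i)) = 0 := rfl
  have h' : (fun i : Fin n => (0 : Fin n ⊕ Fin n →₀ ℕ) (Sum.inr i)) = 0 := rfl
  rw [h, h', DI_zero, DI_zero]

open MvPolynomial in
theorem Op_D {n : ℕ} {A : Type*} [CommRing A] [Algebra ℝ A] (D : Fin n → Derivation ℝ A A)
    (hD : ∀ i j f, D i (D j f) = D j (D i f)) (i : Fin n)
    (P : MvPolynomial (Fin n ⊕ Fin n) ℝ) (f g : A) :
    D i (Op D P f g) = Op D P (D i f) g + Op D P f (D i g) := by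
  induction P using MvPolynomial.induction_on generalizing f g with
  | C r => simp [Op_C]; rw [← smul_add, add_comm, mul_comm g, smul_add]
  | add p q hp hq => simp [hp, hq]; abel
  | mul_X p s hp =>
    rw [mul_comm]
    rcases s with j | j
    · simp only [Op_X_inl D hD, hp, hD i j]
    · simp only [Op_X_inr D hD, hp, hD i j]

open MvPolynomial in
theorem Op_x_inl {n : ℕ} {A : Type*} [CommRing A] [Algebra ℝ A] (D : Fin n → Derivation ℝ A A)
    (hD : ∀ i j f, D i (D j f) = D j (D i f)) (x : Fin n → A)
    (hx : ∀ i j, D i (x j) = if i = j then 1 else 0) (i : Fin n)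
    (P : MvPolynomial (Fin n ⊕ Fin n) ℝ) (f g : A) :
    Op D P (x i * f) g = x i * Op D P f g + Op D (pderiv (Sum.inl i) P) f g := by
  induction P using MvPolynomial.induction_on generalizing f g with
  | C r => simp [Op_C, mul_assoc]
  | add p q hp hq => simp [hp, hq]; ring
  | mul_X p s hp =>
    rw [mul_comm, Derivation.leibniz]
    rcases s with j | j
    · simp only [Op_X_inl D hD, Derivation.leibniz, hx, map_add, pderiv_X, smul_eq_mul,
        LinearMap.add_apply, hp]
      by_cases h : j = i
      · subst h; simp; ring
      · simp [h]
    · simp only [Op_X_inr D hD, hp, pderiv_X, smul_eq_mul, map_add, LinearMap.add_apply]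
      simp

open MvPolynomial in
theorem Op_x_inr {n : ℕ} {A : Type*} [CommRing A] [Algebra ℝ A] (D : Fin n → Derivation ℝ A A)
    (hD : ∀ i j f, D i (D j f) = D j (D i f)) (x : Fin n → A)
    (hx : ∀ i j, D i (x j) = if i = j then 1 else 0) (i : Fin n)
    (P : MvPolynomial (Fin n ⊕ Fin n) ℝ) (f g : A) :
    Op D P f (x i * g) = x i * Op D P f g + Op D (pderiv (Sum.inr i) P) f g := by
  induction P using MvPolynomial.induction_on generalizing f g with
  | C r => simp [Op_C, mul_left_comm]
  | add p q hp hq => simp [hp, hq]; ring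
  | mul_X p s hp =>
    rw [mul_comm, Derivation.leibniz]
    rcases s with j | j
    · simp only [Op_X_inl D hD, hp, pderiv_X, smul_eq_mul, map_add, LinearMap.add_apply]
      simp
    · simp only [Op_X_inr D hD, Derivation.leibniz, hx, map_add, pderiv_X, smul_eq_mul,
        LinearMap.add_apply, hp]
      by_cases h : j = i
      · subst h; simp; ring
      · simp [h]

/-- The inversion operator. -/
noncomputable def Linv {n : ℕ} {A : Type*} [CommRing A] [Algebra ℝ A]
    (D : Fin n → Derivation ℝ A A) (x : Fin n → A) (e : Fin n → ℝ) (i : Fin n) (c : ℝ) (f : A) : A :=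
  ∑ j, e j • (x j * (x j * D i f)) - (2 * e i) • ∑ j, x i * (x j * D j f)
    - (2 * c * e i) • (x i * f)

open MvPolynomial in
theorem half_Linv {n : ℕ} {σ A : Type*} [CommRing A] [Algebra ℝ A]
    (D : Fin n → Derivation ℝ A A) (x : Fin n → A) (e : Fin n → ℝ) (s : Fin n → σ)
    (Φ : MvPolynomial σ ℝ →ₗ[ℝ] A →ₗ[ℝ] A)
    (hX : ∀ i P f, Φ (X (s i) * P) f = Φ P (D i f))
    (hx : ∀ i P f, Φ P (x i * f) = x i * Φ P f + Φ (pderiv (s i) P) f)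
    (i : Fin n) (c : ℝ) (P : MvPolynomial σ ℝ) (f : A) :
    Φ P (Linv D x e i c f) =
      ∑ j, e j • (x j * (x j * Φ P (D i f))) - (2 * e i) • ∑ j, x i * (x j * Φ P (D j f))
      - (2 * c * e i) • (x i * Φ P f) + ∑ j, (2 : ℝ) • (x j * Φ (rotE s e i j P) f)
      - (2 * e i) • (x i * Φ (∑ j, X (s j) * pderiv (s j) P) f) + Φ (invE s e c i P) f := by
  have h1 : ∀ j, Φ P (x j * (x j * D i f)) = x j * (x j * Φ P (D i f))
      + 2 * (x j * Φ (X (s i) * pderiv (s j) P) f)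
      + Φ (X (s i) * pderiv (s j) (pderiv (s j) P)) f := by
    intro j
    rw [hx, hx, hx, hX, hX]; ring
  have h2 : ∀ j, Φ P (x i * (x j * D j f)) = x i * (x j * Φ P (D j f))
      + x i * Φ (X (s j) * pderiv (s j) P) f + x j * Φ (X (s j) * pderiv (s i) P) f
      + Φ (X (s j) * pderiv (s j) (pderiv (s i) P)) f := by
    intro j
    rw [hx, hx, hx, hX, hX, hX]; ring
  have hrot : ∀ j, Φ (rotE s e i j P) f = e j • Φ (X (s i) * pderiv (s j) P) f
      - e i • Φ (X (s j) * pderiv (s i) P) f := by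
    intro j
    simp only [rotE, ← smul_eq_C_mul, map_sub, map_smul, LinearMap.sub_apply,
      LinearMap.smul_apply]
  have hinv : Φ (invE s e c i P) f = ∑ j, e j • Φ (X (s i) * pderiv (s j) (pderiv (s j) P)) f
      - (2 * e i) • ∑ j, Φ (X (s j) * pderiv (s j) (pderiv (s i) P)) f
      - (2 * c * e i) • Φ (pderiv (s i) P) f := by
    simp only [invE, ← smul_eq_C_mul, map_sub, map_smul, LinearMap.sub_apply,
      LinearMap.smul_apply, map_sum, LinearMap.sum_apply, Finset.mul_sum, mul_smul_comm, Finset.smul_sum]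
  have heul : Φ (∑ j, X (s j) * pderiv (s j) P) f = ∑ j, Φ (X (s j) * pderiv (s j) P) f := by
    simp only [map_sum, LinearMap.sum_apply]
  rw [hinv, heul]
  simp only [Linv, hrot, map_sub, map_smul, map_sum, h1, h2, hx i P f]
  simp only [Algebra.smul_def, map_mul, map_ofNat]
  have key : ∑ j, (algebraMap ℝ A (e j) * (x j * (x j * Φ P (D i f))
      + 2 * (x j * Φ (X (s i) * pderiv (s j) P) f)
      + Φ (X (s i) * pderiv (s j) (pderiv (s j) P)) f) -
      2 * algebraMap ℝ A (e i) * (x i * (x j * Φ P (D j f))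
      + x i * Φ (X (s j) * pderiv (s j) P) f + x j * Φ (X (s j) * pderiv (s i) P) f
      + Φ (X (s j) * pderiv (s j) (pderiv (s i) P)) f)) =
      ∑ j, (algebraMap ℝ A (e j) * (x j * (x j * Φ P (D i f)))
        - 2 * algebraMap ℝ A (e i) * (x i * (x j * Φ P (D j f)))
        + 2 * (x j * (algebraMap ℝ A (e j) * Φ (X (s i) * pderiv (s j) P) f
          - algebraMap ℝ A (e i) * Φ (X (s j) * pderiv (s i) P) f))
        - 2 * algebraMap ℝ A (e i) * (x i * Φ (X (s j) * pderiv (s j) P) f)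
        + algebraMap ℝ A (e j) * Φ (X (s i) * pderiv (s j) (pderiv (s j) P)) f
        - 2 * algebraMap ℝ A (e i) * Φ (X (s j) * pderiv (s j) (pderiv (s i) P)) f) := by
    refine Finset.sum_congr rfl fun j _ => ?_
    ring
  rw [Finset.sum_sub_distrib, ← Finset.mul_sum] at key
  rw [key]
  simp only [Finset.sum_add_distrib, Finset.sum_sub_distrib, ← Finset.mul_sum]
  ring

open MvPolynomial in
/-- `Op` in the first slot. -/
noncomputable def OpL {n : ℕ} {A : Type*} [CommRing A] [Algebra ℝ A] (D : Fin n → Derivation ℝ A A)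
    (g : A) : MvPolynomial (Fin n ⊕ Fin n) ℝ →ₗ[ℝ] A →ₗ[ℝ] A :=
  LinearMap.mk₂ ℝ (fun P f => Op D P f g) (by intros; simp) (by intros; simp) (by intros; simp)
    (by intros; simp)

open MvPolynomial in
/-- `Op` in the second slot. -/
noncomputable def OpR {n : ℕ} {A : Type*} [CommRing A] [Algebra ℝ A] (D : Fin n → Derivation ℝ A A)
    (f : A) : MvPolynomial (Fin n ⊕ Fin n) ℝ →ₗ[ℝ] A →ₗ[ℝ] A :=
  LinearMap.mk₂ ℝ (fun P g => Op D P f g) (by intros; simp) (by intros; simp) (by intros; simp)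
    (by intros; simp)

open MvPolynomial in
theorem Op_euler {n : ℕ} {A : Type*} [CommRing A] [Algebra ℝ A] (D : Fin n → Derivation ℝ A A)
    (k : ℕ) (P : MvPolynomial (Fin n ⊕ Fin n) ℝ) (hP : P.IsHomogeneous (2 * k)) (f g : A) :
    Op D (∑ j, X (Sum.inl j) * pderiv (Sum.inl j) P) f g +
      Op D (∑ j, X (Sum.inr j) * pderiv (Sum.inr j) P) f g = (2 * k : ℝ) • Op D P f g := by
  have h := hP.sum_X_mul_pderiv
  rw [Fintype.sum_sum_type] at h
  have h2 := congrArg (fun Q => Op D Q f g) h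
  simp only [map_add, LinearMap.add_apply] at h2
  rw [h2, ← Nat.cast_smul_eq_nsmul ℝ]
  simp

open MvPolynomial in
theorem Op_Linv {n : ℕ} {A : Type*} [CommRing A] [Algebra ℝ A] (D : Fin n → Derivation ℝ A A)
    (hD : ∀ i j f, D i (D j f) = D j (D i f)) (x : Fin n → A)
    (hx : ∀ i j, D i (x j) = if i = j then 1 else 0) (e : Fin n → ℝ) (k : ℕ) (a b : ℝ)
    (P : MvPolynomial (Fin n ⊕ Fin n) ℝ) (hP : GoodSymbol e k a b P) (i : Fin n) (f g : A) :
    Linv D x e i (a + b + 2 * k) (Op D P f g) =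
      Op D P (Linv D x e i a f) g + Op D P f (Linv D x e i b g) := by
  obtain ⟨hh, hr, hi⟩ := hP
  have hL := half_Linv D x e Sum.inl (OpL D g) (fun i P f => Op_X_inl D hD i P f g)
    (fun i P f => Op_x_inl D hD x hx i P f g) i a P f
  have hR := half_Linv D x e Sum.inr (OpR D f) (fun i P g => Op_X_inr D hD i P f g)
    (fun i P g => Op_x_inr D hD x hx i P f g) i b P g
  have he := Op_euler D k P hh f g
  have hi2 := congrArg (fun Q => Op D Q f g) (hi i)
  have hr2 : ∀ j, Op D (rotE Sum.inr e i j P) f g = - Op D (rotE Sum.inl e i j P) f g := by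
    intro j
    have := congrArg (fun Q => Op D Q f g) (hr i j)
    simp only [map_add, LinearMap.add_apply, map_zero, LinearMap.zero_apply] at this
    exact eq_neg_of_add_eq_zero_right this
  simp only [map_add, LinearMap.add_apply, map_zero, LinearMap.zero_apply] at hi2
  simp only [OpL, OpR, LinearMap.mk₂_apply] at hL hR
  rw [hL, hR]
  simp only [hr2, Linv, Op_D D hD]
  simp only [Algebra.smul_def, map_mul, map_ofNat, map_add, map_natCast] at he ⊢
  simp only [mul_add, mul_neg, Finset.sum_add_distrib, Finset.sum_neg_distrib]
  linear_combination 2 * algebraMap ℝ A (e i) * x i * he - hi2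

open MvPolynomial in
theorem Op_rot {n : ℕ} {A : Type*} [CommRing A] [Algebra ℝ A] (D : Fin n → Derivation ℝ A A)
    (hD : ∀ i j f, D i (D j f) = D j (D i f)) (x : Fin n → A)
    (hx : ∀ i j, D i (x j) = if i = j then 1 else 0) (e : Fin n → ℝ) (k : ℕ) (a b : ℝ)
    (P : MvPolynomial (Fin n ⊕ Fin n) ℝ) (hP : GoodSymbol e k a b P) (i j : Fin n) (f g : A) :
    e i • (x i * D j (Op D P f g)) - e j • (x j * D i (Op D P f g)) =
      Op D P (e i • (x i * D j f) - e j • (x j * D i f)) g +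
      Op D P f (e i • (x i * D j g) - e j • (x j * D i g)) := by
  have hr := congrArg (fun Q => Op D Q f g) (hP.2.1 i j)
  simp only [rotE, ← smul_eq_C_mul, map_add, map_sub, map_smul, LinearMap.add_apply,
    LinearMap.sub_apply, LinearMap.smul_apply, map_zero, LinearMap.zero_apply, Op_X_inl D hD,
    Op_X_inr D hD] at hr
  simp only [map_sub, map_smul, LinearMap.sub_apply, LinearMap.smul_apply, Op_D D hD,
    Op_x_inl D hD x hx, Op_x_inr D hD x hx]
  simp only [Algebra.smul_def] at hr ⊢
  linear_combination hr

open MvPolynomial in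
theorem Op_eul {n : ℕ} {A : Type*} [CommRing A] [Algebra ℝ A] (D : Fin n → Derivation ℝ A A)
    (hD : ∀ i j f, D i (D j f) = D j (D i f)) (x : Fin n → A)
    (hx : ∀ i j, D i (x j) = if i = j then 1 else 0) (k : ℕ) (a b : ℝ)
    (P : MvPolynomial (Fin n ⊕ Fin n) ℝ) (hP : P.IsHomogeneous (2 * k)) (f g : A) :
    ∑ j, x j * D j (Op D P f g) + (a + b + 2 * k) • Op D P f g =
      Op D P (∑ j, x j * D j f + a • f) g + Op D P f (∑ j, x j * D j g + b • g) := by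
  have he := Op_euler D k P hP f g
  simp only [map_sum, LinearMap.sum_apply, Op_X_inl D hD, Op_X_inr D hD] at he
  simp only [map_add, map_sum, map_smul, LinearMap.add_apply, LinearMap.sum_apply,
    LinearMap.smul_apply, Op_D D hD, Op_x_inl D hD x hx, Op_x_inr D hD x hx, mul_add,
    Finset.sum_add_distrib, add_smul, ← he]
  abel

/-- Lie derivative in the algebra. -/
noncomputable def lieA {n : ℕ} {A : Type*} [CommRing A] [Algebra ℝ A] (D : Fin n → Derivation ℝ A A)
    (Y : Fin n → A) (l : ℝ) (f : A) : A :=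
  ∑ i, Y i * D i f + l • ((∑ i, D i (Y i)) * f)

open MvPolynomial in
theorem Op_exp {n : ℕ} {A : Type*} [CommRing A] [Algebra ℝ A] (D : Fin n → Derivation ℝ A A)
    (hD : ∀ i j f, D i (D j f) = D j (D i f))
    (P : MvPolynomial (Fin n ⊕ Fin n) ℝ) (ξ η : Fin n → ℝ) (f g : A)
    (hf : ∀ i, D i f = ξ i • f) (hg : ∀ i, D i g = η i • g) :
    Op D P f g = eval (Sum.elim ξ η) P • (f * g) := by
  induction P using MvPolynomial.induction_on with
  | C r => simp [Op_C]
  | add p q hp hq => simp only [map_add, LinearMap.add_apply, hp, hq, add_smul]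
  | mul_X p s hp =>
    rw [mul_comm]
    rcases s with j | j
    · rw [Op_X_inl D hD, hf]
      simp only [map_smul, LinearMap.smul_apply, hp, map_mul, eval_X, Sum.elim_inl, mul_smul]
    · rw [Op_X_inr D hD, hg]
      simp only [map_smul, hp, map_mul, eval_X, Sum.elim_inr, mul_smul]

theorem lieA_trans {n : ℕ} {A : Type*} [CommRing A] [Algebra ℝ A] (D : Fin n → Derivation ℝ A A)
    (i : Fin n) (l : ℝ) (f : A) :
    lieA D (fun j => if j = i then 1 else 0) l f = D i f := by
  unfold lieA
  have : ∀ j, D j (if j = i then 1 else 0 : A) = 0 := by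
    intro j; split_ifs <;> simp
  simp [this]

theorem lieA_rot {n : ℕ} {A : Type*} [CommRing A] [Algebra ℝ A] (D : Fin n → Derivation ℝ A A)
    (x : Fin n → A)
    (hx : ∀ i j, D i (x j) = if i = j then 1 else 0) (e : Fin n → ℝ) (i j : Fin n) (l : ℝ) (f : A) :
    lieA D (fun t => e i • (if t = j then x i else 0) - e j • (if t = i then x j else 0)) l f =
      e i • (x i * D j f) - e j • (x j * D i f) := by
  unfold lieA
  have h1 : ∀ t a b : Fin n, D t (if t = b then x a else 0 : A) =
      if t = b then (if t = a then 1 else 0) else 0 := by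
    intro t a b; split_ifs <;> simp_all
  have h2 : ∑ t, D t (e i • (if t = j then x i else 0) - e j • (if t = i then x j else 0)
      : A) = 0 := by
    simp only [map_sub, Derivation.map_smul, h1, Finset.sum_sub_distrib, ← Finset.smul_sum]
    by_cases h : i = j
    · subst h; simp
    · simp [h, Ne.symm h]
  rw [h2]
  simp only [sub_mul, Finset.sum_sub_distrib, smul_mul_assoc, ← Finset.smul_sum, ite_mul, zero_mul]
  simp

theorem lieA_euler {n : ℕ} {A : Type*} [CommRing A] [Algebra ℝ A] (D : Fin n → Derivation ℝ A A)
    (x : Fin n → A)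
    (hx : ∀ i j, D i (x j) = if i = j then 1 else 0) (l : ℝ) (f : A) :
    lieA D x l f = ∑ j, x j * D j f + (n * l) • f := by
  unfold lieA
  simp only [hx, if_true, Finset.sum_const, Finset.card_univ, Fintype.card_fin]
  congr 1
  rw [nsmul_one]
  simp only [Algebra.smul_def, map_mul, map_natCast]
  ring

theorem lieA_inv {n : ℕ} {A : Type*} [CommRing A] [Algebra ℝ A] (D : Fin n → Derivation ℝ A A)
    (x : Fin n → A)
    (hx : ∀ i j, D i (x j) = if i = j then 1 else 0) (e : Fin n → ℝ) (i : Fin n) (l : ℝ) (f : A) :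
    lieA D (fun t => (if t = i then ∑ j, e j • (x j * x j) else 0) - (2 * e i) • (x i * x t)) l f
      = Linv D x e i (n * l) f := by
  unfold lieA
  have h1 : ∀ t, D t (if t = i then ∑ j, e j • (x j * x j) else 0 : A) =
      if t = i then (2 * e i) • x i else 0 := by
    intro t
    split_ifs with h
    · subst h
      simp [hx, mul_ite, smul_add, Finset.sum_add_distrib]
      module
    · simp
  have h2 : ∀ t, D t (x i * x t : A) = x i + if t = i then x i else 0 := by
    intro t
    by_cases h : t = i
    · subst h; simp [hx]
    · simp [hx, h]
  have h3 : ∑ t, D t ((if t = i then ∑ j, e j • (x j * x j) else 0)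
      - (2 * e i) • (x i * x t) : A) = (-(2 * n * e i)) • x i := by
    simp only [map_sub, Derivation.map_smul, h1, h2, Finset.sum_sub_distrib, ← Finset.smul_sum,
      Finset.sum_add_distrib]
    simp
    simp only [Algebra.smul_def, map_mul, map_natCast, map_ofNat, map_neg]
    ring
  rw [h3]
  unfold Linv
  have h4 : ∑ t, ((if t = i then ∑ j, e j • (x j * x j) else 0) - (2 * e i) • (x i * x t)) * D t f
      = ∑ j, e j • (x j * (x j * D i f)) - (2 * e i) • ∑ j, x i * (x j * D j f) := by
    simp only [sub_mul, Finset.sum_sub_distrib, smul_mul_assoc, ← Finset.smul_sum, ite_mul,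
      zero_mul, mul_assoc]
    simp [Finset.sum_mul, mul_assoc]
  rw [h4, sub_eq_add_neg _ ((2 * (n * l) * e i) • (x i * f))]
  congr 1
  simp only [Algebra.smul_def, map_mul, map_natCast, map_ofNat, map_neg]
  ring


/-- The algebra of smooth functions. -/
def SmA (n : ℕ) : Subalgebra ℝ ((Fin n → ℝ) → ℝ) where
  carrier := {f | ContDiff ℝ (⊤ : ℕ∞) f}
  mul_mem' := fun {a b} (ha : ContDiff ℝ (⊤ : ℕ∞) a) (hb : ContDiff ℝ (⊤ : ℕ∞) b) => ContDiff.mul ha hb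
  add_mem' := fun {a b} (ha : ContDiff ℝ (⊤ : ℕ∞) a) (hb : ContDiff ℝ (⊤ : ℕ∞) b) => ContDiff.add ha hb
  algebraMap_mem' := fun r => (contDiff_const : ContDiff ℝ (⊤ : ℕ∞) (fun _ : Fin n → ℝ => r))

theorem SmA_cd {n : ℕ} (f : SmA n) : ContDiff ℝ (⊤ : ℕ∞) (f : (Fin n → ℝ) → ℝ) := f.2

theorem SmA_diff {n : ℕ} (f : SmA n) : Differentiable ℝ (f : (Fin n → ℝ) → ℝ) :=
  (SmA_cd f).differentiable (by simp)

theorem pd_smooth {n : ℕ} (i : Fin n) (f : SmA n) : ContDiff ℝ (⊤ : ℕ∞) (pd i (f : (Fin n → ℝ) → ℝ)) := by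
  unfold pd
  exact ((SmA_cd f).fderiv_right (m := (⊤ : ℕ∞)) (by exact_mod_cast le_refl _)).clm_apply
    contDiff_const

/-- Partial derivatives as derivations. -/
noncomputable def Dm {n : ℕ} (i : Fin n) : Derivation ℝ (SmA n) (SmA n) :=
  Derivation.mk'
    { toFun := fun f => ⟨pd i f, pd_smooth i f⟩
      map_add' := by
        intro f g
        ext x
        have := fderiv_add (SmA_diff f x) (SmA_diff g x)
        simp [pd, this]
      map_smul' := by
        intro r f
        ext x
        have := fderiv_const_smul (SmA_diff f x) r
        simp [pd, this] }
    (by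
      intro f g
      ext x
      have := fderiv_mul (SmA_diff f x) (SmA_diff g x)
      simp [pd, this])

theorem Dm_coe {n : ℕ} (i : Fin n) (f : SmA n) :
    ((Dm i f : SmA n) : (Fin n → ℝ) → ℝ) = pd i (f : (Fin n → ℝ) → ℝ) := rfl

theorem Dm_comm {n : ℕ} (i j : Fin n) (f : SmA n) : Dm i (Dm j f) = Dm j (Dm i f) := by
  ext x
  rw [Dm_coe, Dm_coe, Dm_coe, Dm_coe]
  have hd : DifferentiableAt ℝ (fderiv ℝ (f : (Fin n → ℝ) → ℝ)) x :=
    ((SmA_cd f).fderiv_right (m := (⊤ : ℕ∞)) (by exact_mod_cast le_refl _)).differentiable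
      (by simp) x
  have hs : IsSymmSndFDerivAt ℝ (f : (Fin n → ℝ) → ℝ) x :=
    (SmA_cd f).contDiffAt.isSymmSndFDerivAt (by
      simp only [minSmoothness_of_isRCLikeNormedField]
      exact WithTop.coe_le_coe.2 (le_top : (2 : ℕ∞) ≤ ⊤))
  have key : ∀ a b : Fin n, pd a (pd b (f : (Fin n → ℝ) → ℝ)) x =
      fderiv ℝ (fderiv ℝ (f : (Fin n → ℝ) → ℝ)) x (Pi.single a 1) (Pi.single b 1) := by
    intro a b
    unfold pd
    rw [fderiv_clm_apply hd (differentiableAt_const _)]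
    simp
  rw [key, key]
  exact hs _ _

/-- Coordinates. -/
def xA {n : ℕ} (i : Fin n) : SmA n := ⟨fun x => x i,
  (contDiff_apply ℝ ℝ i : ContDiff ℝ (⊤ : ℕ∞) (fun x : Fin n → ℝ => x i))⟩

theorem Dm_xA {n : ℕ} (i j : Fin n) : Dm i (xA j) = if i = j then 1 else 0 := by
  ext x
  rw [Dm_coe]
  have : fderiv ℝ (xA j : (Fin n → ℝ) → ℝ) x = ContinuousLinearMap.proj j :=
    (ContinuousLinearMap.proj (R := ℝ) (φ := fun _ : Fin n => ℝ) j).fderiv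
  rw [pd, this]
  by_cases h : i = j
  · subst h; simp
  · simp [h, Ne.symm h]

/-- Exponentials. -/
def eA {n : ℕ} (ξ : Fin n → ℝ) : SmA n := ⟨fun x => Real.exp (∑ i, ξ i * x i), by
  have : ContDiff ℝ (⊤ : ℕ∞) (fun x : Fin n → ℝ => Real.exp (∑ i, ξ i * x i)) := by fun_prop
  exact this⟩

theorem Dm_eA {n : ℕ} (i : Fin n) (ξ : Fin n → ℝ) : Dm i (eA ξ) = ξ i • eA ξ := by
  ext x
  rw [Dm_coe]
  let L : (Fin n → ℝ) →L[ℝ] ℝ :=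
    ∑ i, ξ i • ContinuousLinearMap.proj (R := ℝ) (φ := fun _ : Fin n => ℝ) i
  have hL : ∀ y, L y = ∑ i, ξ i * y i := by
    intro y
    simp [L]
  have h : HasFDerivAt (eA ξ : (Fin n → ℝ) → ℝ) (Real.exp (L x) • L) x := by
    have h0 := (L.hasFDerivAt (x := x)).exp
    have : (eA ξ : (Fin n → ℝ) → ℝ) = fun y => Real.exp (L y) := by
      funext y; rw [hL]; rfl
    rw [this]
    exact h0
  have h1 : L (Pi.single i 1) = ξ i := by
    rw [hL]
    simp [Pi.single_apply]
  rw [pd, h.fderiv]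
  simp only [_root_.smul_apply, h1, hL]
  change Real.exp _ * ξ i = ξ i * Real.exp _
  ring

theorem exists_model (n : ℕ) : ∃ (A : Type) (_ : CommRing A) (_ : Algebra ℝ A)
    (D : Fin n → Derivation ℝ A A) (ev : A →ₐ[ℝ] ((Fin n → ℝ) → ℝ)) (x : Fin n → A)
    (ex : (Fin n → ℝ) → A),
    (∀ i f, ev (D i f) = pd i (ev f)) ∧ (∀ i j f, D i (D j f) = D j (D i f)) ∧
    (∀ i j, D i (x j) = if i = j then 1 else 0) ∧ (∀ i y, ev (x i) y = y i) ∧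
    (∀ i ξ, D i (ex ξ) = ξ i • ex ξ) ∧ (∀ ξ, ev (ex ξ) 0 = 1) ∧
    (∀ f, ContDiff ℝ (⊤ : ℕ∞) (ev f)) ∧
    (∀ f : (Fin n → ℝ) → ℝ, ContDiff ℝ (⊤ : ℕ∞) f → ∃ a, ev a = f) :=
  ⟨SmA n, inferInstance, inferInstance, Dm, (SmA n).val, xA, eA, fun _ _ => rfl, Dm_comm, Dm_xA,
    fun _ _ => rfl, Dm_eA, fun ξ => by simp [eA], SmA_cd, fun f hf => ⟨⟨f, hf⟩, rfl⟩⟩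


theorem pdIter_coe {n : ℕ} {A : Type*} [CommRing A] [Algebra ℝ A]
    (D : Fin n → Derivation ℝ A A) (ev : A →ₐ[ℝ] ((Fin n → ℝ) → ℝ))
    (hev : ∀ i f, ev (D i f) = pd i (ev f))
    (α : Fin n → ℕ) (f : A) :
    pdIter α (ev f) = ev (DI D α f) := by
  unfold pdIter DI
  have hp : ∀ (i : Fin n) (t : ℕ) (h : A), (pd i)^[t] (ev h) =
      ev ((((D i : A →ₗ[ℝ] A) : Module.End ℝ A) ^ t) h) := by
    intro i t
    induction t with
    | zero => intro h; simp
    | succ t ih =>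
      intro h
      rw [Function.iterate_succ_apply, ← hev, ih, pow_succ]
      rfl
  induction List.finRange n with
  | nil => simp
  | cons i L ih =>
    rw [List.foldr_cons, ih, hp, List.map_cons, List.prod_cons]
    rfl

theorem lieD_coe {n : ℕ} {A : Type*} [CommRing A] [Algebra ℝ A]
    (D : Fin n → Derivation ℝ A A) (ev : A →ₐ[ℝ] ((Fin n → ℝ) → ℝ))
    (hev : ∀ i f, ev (D i f) = pd i (ev f))
    (Z : (Fin n → ℝ) → (Fin n → ℝ)) (Y : Fin n → A)
    (hY : ∀ y i, Z y i = ev (Y i) y) (l : ℝ) (f : A) :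
    lieD Z l (ev f) = ev (lieA D Y l f) := by
  funext x
  have h : ∀ i, (fun y => Z y i) = ev (Y i) := fun i => funext fun y => hY y i
  simp only [lieD, lieA, h, hY, ← hev]
  simp [mul_assoc]

open MvPolynomial in
/-- Coefficients of the operator. -/
noncomputable def bco {n : ℕ} (P : MvPolynomial (Fin n ⊕ Fin n) ℝ) (α γ : Fin n → ℕ) : ℝ :=
  coeff (Finsupp.equivFunOnFinite.symm (Sum.elim α γ)) P

open MvPolynomial in
theorem bco_zero {n : ℕ} (k : ℕ) (P : MvPolynomial (Fin n ⊕ Fin n) ℝ)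
    (hP : P.IsHomogeneous (2 * k)) (α γ : Fin n → ℕ) (h : (∑ i, α i) + (∑ i, γ i) ≠ 2 * k) :
    bco P α γ = 0 := by
  unfold bco
  apply hP.coeff_eq_zero
  rw [Finsupp.degree_eq_sum]
  simpa [Fintype.sum_sum_type] using h

open MvPolynomial in
theorem Bop_coe {n : ℕ} {A : Type*} [CommRing A] [Algebra ℝ A]
    (D : Fin n → Derivation ℝ A A) (ev : A →ₐ[ℝ] ((Fin n → ℝ) → ℝ))
    (hev : ∀ i f, ev (D i f) = pd i (ev f))
    (k : ℕ) (P : MvPolynomial (Fin n ⊕ Fin n) ℝ)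
    (hP : P.IsHomogeneous (2 * k)) (f g : A) :
    Bop n (2 * k) (bco P) (ev f) (ev g) = ev (Op D P f g) := by
  funext x
  unfold Bop
  rw [← Finset.sum_product']
  let E : (Fin n ⊕ Fin n →₀ ℕ) ≃ (Fin n → ℕ) × (Fin n → ℕ) :=
    Finsupp.equivFunOnFinite.trans (Equiv.sumArrowEquivProdArrow (Fin n) (Fin n) ℕ)
  have hE : ∀ α γ, bco P α γ = coeff (E.symm (α, γ)) P := by
    intro α γ; rfl
  have hsub : P.support.map E.toEmbedding ⊆
      Finset.Iic (fun _ => 2 * k : Fin n → ℕ) ×ˢ Finset.Iic (fun _ => 2 * k : Fin n → ℕ) := by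
    rintro ⟨α, γ⟩ h
    rw [Finset.mem_map_equiv, mem_support_iff, ← hE] at h
    have h2 : (∑ i, α i) + (∑ i, γ i) = 2 * k := by
      by_contra hne
      exact h (bco_zero k P hP α γ hne)
    simp only [Finset.mem_product, Finset.mem_Iic, Pi.le_def]
    refine ⟨fun i => ?_, fun i => ?_⟩
    · have := Finset.single_le_sum (f := α) (fun _ _ => Nat.zero_le _) (Finset.mem_univ i)
      omega
    · have := Finset.single_le_sum (f := γ) (fun _ _ => Nat.zero_le _) (Finset.mem_univ i)
      omega
  rw [← Finset.sum_subset hsub]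
  · rw [Finset.sum_map]
    conv_rhs => rw [P.as_sum]
    simp only [map_sum, LinearMap.sum_apply, Op_monomial]
    simp only [pdIter_coe D ev hev, hE]
    simp [mul_assoc]
    rfl
  · rintro ⟨α, γ⟩ _ h
    rw [Finset.mem_map_equiv, notMem_support_iff, ← hE] at h
    simp [h]

open MvPolynomial in
theorem Op_ne_zero {n : ℕ} {A : Type*} [CommRing A] [Algebra ℝ A]
    (D : Fin n → Derivation ℝ A A) (ev : A →ₐ[ℝ] ((Fin n → ℝ) → ℝ))
    (hD : ∀ i j f, D i (D j f) = D j (D i f)) (ex : (Fin n → ℝ) → A)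
    (hex : ∀ i ξ, D i (ex ξ) = ξ i • ex ξ) (hex0 : ∀ ξ, ev (ex ξ) 0 = 1)
    (P : MvPolynomial (Fin n ⊕ Fin n) ℝ) (hP : P ≠ 0) :
    ∃ f g : A, ev (Op D P f g) ≠ 0 := by
  by_contra! hcon
  apply hP
  apply MvPolynomial.funext
  intro z
  have h := congrFun (hcon (ex fun i => z (Sum.inl i)) (ex fun i => z (Sum.inr i))) 0
  rw [Op_exp D hD P (fun i => z (Sum.inl i)) (fun i => z (Sum.inr i)) _ _
    (fun i => hex i _) (fun i => hex i _)] at h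
  have hz : Sum.elim (fun i => z (Sum.inl i)) (fun i => z (Sum.inr i)) = z := by
    ext s; rcases s with s | s <;> rfl
  rw [hz] at h
  simpa [hex0] using h

theorem inv_of_good {p : ℕ} {n : ℕ} {A : Type*} [CommRing A] [Algebra ℝ A]
    (D : Fin n → Derivation ℝ A A) (ev : A →ₐ[ℝ] ((Fin n → ℝ) → ℝ))
    (hev : ∀ i f, ev (D i f) = pd i (ev f))
    (hD : ∀ i j f, D i (D j f) = D j (D i f)) (x : Fin n → A)
    (hx : ∀ i j, D i (x j) = if i = j then 1 else 0) (hxe : ∀ i y, ev (x i) y = y i)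
    (hsm : ∀ f : (Fin n → ℝ) → ℝ, ContDiff ℝ (⊤ : ℕ∞) f → ∃ a, ev a = f)
    (hn1 : 1 ≤ n) (k : ℕ) (l m : ℝ)
    (P : MvPolynomial (Fin n ⊕ Fin n) ℝ)
    (hP : GoodSymbol (eps p : Fin n → ℝ) k (n * l) (n * m) P) :
    BiConfInv p n l m (l + m + 2 * k / n) (Bop n (2 * k) (bco P)) := by
  have hn0 : (n : ℝ) ≠ 0 := by positivity
  have hnu : (n : ℝ) * (l + m + 2 * k / n) = n * l + n * m + 2 * k := by
    field_simp
  have main : ∀ (Z : (Fin n → ℝ) → (Fin n → ℝ)) (Y : Fin n → A),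
      (∀ y i, Z y i = ev (Y i) y) →
      (∀ f g, lieA D Y (l + m + 2 * k / n) (Op D P f g) =
        Op D P (lieA D Y l f) g + Op D P f (lieA D Y m g)) →
      ∀ f g : (Fin n → ℝ) → ℝ, ContDiff ℝ (⊤ : ℕ∞) f → ContDiff ℝ (⊤ : ℕ∞) g →
      lieD Z (l + m + 2 * k / n) (Bop n (2 * k) (bco P) f g) =
        fun x => Bop n (2 * k) (bco P) (lieD Z l f) g x + Bop n (2 * k) (bco P) f (lieD Z m g) x := by
    intro Z Y hY hL f g hf hg
    obtain ⟨f, rfl⟩ := hsm f hf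
    obtain ⟨g, rfl⟩ := hsm g hg
    rw [Bop_coe D ev hev k P hP.1, lieD_coe D ev hev Z Y hY, lieD_coe D ev hev Z Y hY,
      lieD_coe D ev hev Z Y hY, Bop_coe D ev hev k P hP.1, Bop_coe D ev hev k P hP.1, hL, map_add]
    rfl
  rintro Z (((⟨i, rfl⟩ | ⟨i, j, rfl⟩) | hZ) | ⟨i, rfl⟩)
  · apply main _ (fun j => if j = i then 1 else 0)
    · intro y j
      simp only [Xtrans, Pi.single_apply]
      split_ifs <;> simp
    · intro f g
      rw [lieA_trans, lieA_trans, lieA_trans]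
      exact Op_D D hD i P f g
  · apply main _ (fun t => eps p i • (if t = j then x i else 0)
      - eps p j • (if t = i then x j else 0))
    · intro y t
      simp only [Xrot, Pi.single_apply, Pi.sub_apply, Pi.smul_apply]
      split_ifs <;> simp [hxe]
    · intro f g
      rw [lieA_rot D x hx (eps p), lieA_rot D x hx (eps p), lieA_rot D x hx (eps p)]
      exact Op_rot D hD x hx (eps p) k _ _ P hP i j f g
  · rw [Set.mem_singleton_iff] at hZ
    subst hZ
    apply main _ x
    · intro y t; exact (hxe t y).symm
    · intro f g
      rw [lieA_euler D x hx, lieA_euler D x hx, lieA_euler D x hx, hnu]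
      exact Op_eul D hD x hx k _ _ P hP.1 f g
  · apply main _ (fun t => (if t = i then ∑ j, eps p j • (x j * x j) else 0)
      - (2 * eps p i) • (x i * x t))
    · intro y t
      simp only [Xinv, Pi.single_apply, Pi.sub_apply, Pi.smul_apply]
      split_ifs <;> simp [hxe, pow_two, mul_assoc]
    · intro f g
      rw [lieA_inv D x hx (eps p), lieA_inv D x hx (eps p),
        lieA_inv D x hx (eps p), hnu]
      exact Op_Linv D hD x hx (eps p) k _ _ P hP i f g


/-- (Theorem 2.2, existence.) For `λ, μ ∉ {0, 1/n, 2/n, …}` and every `k ≥ 0` there exists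
a nonzero constant-coefficient bilinear differential operator of order `≤ 2k` which is
`o(p+1,q+1)`-invariant from `F_λ ⊗ F_μ` to `F_{λ+μ+2k/n}`. -/
theorem exists_invariant_bilinear_operator (p q n : ℕ) (hn : n = p + q) (hn1 : 1 ≤ n)
    (k : ℕ) (l m : ℝ)
    (hl : ∀ j : ℕ, l ≠ (j : ℝ) / n) (hm : ∀ j : ℕ, m ≠ (j : ℝ) / n) :
    ∃ b : (Fin n → ℕ) → (Fin n → ℕ) → ℝ,
      (∀ α γ : Fin n → ℕ, 2 * k < (∑ i, α i) + (∑ i, γ i) → b α γ = 0) ∧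
      (∃ f g : (Fin n → ℝ) → ℝ, ContDiff ℝ (⊤ : ℕ∞) f ∧ ContDiff ℝ (⊤ : ℕ∞) g ∧
        Bop n (2 * k) b f g ≠ 0) ∧
      BiConfInv p n l m (l + m + 2 * k / n) (Bop n (2 * k) b) := by
  have hE : ∀ i : Fin n, (eps p i) * (eps p i) = 1 := by
    intro i
    unfold eps
    split_ifs <;> norm_num
  have hP : ∃ P, P ≠ 0 ∧ GoodSymbol (eps p : Fin n → ℝ) k (n * l) (n * m) P := by
    rcases Nat.lt_or_ge 1 n with h | h
    · exact exists_good_ge_two h (eps p) hE k _ _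
    · have h1 : n = 1 := le_antisymm h hn1
      clear hn hl hm hE
      subst h1
      exact exists_good_one (eps p) k _ _
  obtain ⟨P, hP0, hP⟩ := hP
  obtain ⟨A, _, _, D, ev, x, ex, hev, hD, hx, hxe, hex, hex0, hcd, hsm⟩ := exists_model n
  refine ⟨bco P, ?_, ?_, ?_⟩
  · intro α γ h
    exact bco_zero k P hP.1 α γ h.ne'
  · obtain ⟨f, g, hfg⟩ := Op_ne_zero D ev hD ex hex hex0 P hP0
    refine ⟨ev f, ev g, hcd f, hcd g, ?_⟩
    rw [Bop_coe D ev hev k P hP.1]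
    exact hfg
  · exact inv_of_good D ev hev hD x hx hxe hsm hn1 k l m P hP

end
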